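/- arXiv:2510.09922 — 12 statements merged into one kernel-verified Lean document; each statement's English description precedes it below -/
import Mathlib

section
/- For every n ≥ 2, in the braid group B_{n+1} the elements σ_n and Δ_n² satisfy σ_nΔ_n²σ_nΔ_n² = Δ_n²σ_nΔ_n²σ_n. Consequently there is a group homomorphism from the affine braid group AB_2 to B_{n+1} sending τ to Δ_n² and σ to σ_n. -/
/-- The braid relations for the braid group with `n` generators (on `n+1` strands). -/
def braidRels (n : ℕ) : Set (FreeGroup (Fin n)) :=
  { r | (∃ i j : Fin n, i.val + 1 = j.val ∧
          r = FreeGroup.of i * FreeGroup.of j * FreeGroup.of i *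
              (FreeGroup.of j * FreeGroup.of i * FreeGroup.of j)⁻¹) ∨
        (∃ i j : Fin n, i.val + 2 ≤ j.val ∧
          r = FreeGroup.of i * FreeGroup.of j * (FreeGroup.of j * FreeGroup.of i)⁻¹) }

/-- The braid group `B_{n+1}` on `n+1` strands, with generators `σ_1, …, σ_n`
indexed by `Fin n`. -/
abbrev BraidGroup (n : ℕ) := PresentedGroup (braidRels n)

/-- The generator `σ_{i+1}` of the braid group. -/
def braidGen {n : ℕ} (i : Fin n) : BraidGroup n := PresentedGroup.of i

/-- The word `σ_k σ_{k-1} ⋯ σ_1` in the free group (generator `σ_j` has index `j-1`). -/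
def descWord : ℕ → FreeGroup ℕ
  | 0 => 1
  | k + 1 => FreeGroup.of k * descWord k

/-- The half-twist word: `Δ_2 = σ_1`, `Δ_{m+1} = Δ_m σ_m σ_{m-1} ⋯ σ_1`. -/
def deltaWord : ℕ → FreeGroup ℕ
  | 0 => 1
  | 1 => 1
  | m + 2 => deltaWord (m + 1) * descWord (m + 1)

/-- Interpretation of words on the generators `σ_1, σ_2, …` in the braid group `B_{n+1}`
(out-of-range letters are sent to `1`; they never occur in the words we use). -/
def toBraid (n : ℕ) : FreeGroup ℕ →* BraidGroup n :=
  FreeGroup.lift fun k => if h : k < n then braidGen ⟨k, h⟩ else 1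

/-- The half twist `Δ_m`, viewed in the braid group `B_{n+1}` (for `m ≤ n+1`). -/
def deltaElem (n m : ℕ) : BraidGroup n := toBraid n (deltaWord m)

/-- The affine braid group `AB_2`: generators `σ` (= `of true`) and `τ` (= `of false`)
with the single relation `στστ = τστσ`. -/
def ab2Rels : Set (FreeGroup Bool) :=
  { FreeGroup.of true * FreeGroup.of false * FreeGroup.of true * FreeGroup.of false *
    (FreeGroup.of false * FreeGroup.of true * FreeGroup.of false * FreeGroup.of true)⁻¹ }

abbrev AffineBraid2 := PresentedGroup ab2Rels

/-- The word `σ_1 σ_2 ⋯ σ_k` in the free group. -/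
def ascWord : ℕ → FreeGroup ℕ
  | 0 => 1
  | k + 1 => ascWord k * FreeGroup.of k

theorem deltaWord_succ (m : ℕ) : deltaWord (m + 1) = deltaWord m * descWord m := by
  cases m <;> simp [deltaWord, descWord]

/-- The first `N` letters satisfy the braid relations under `f`, and all distant letters commute. -/
structure SatisfiesBraidRels {G : Type*} [Group G] (f : FreeGroup ℕ →* G) (N : ℕ) : Prop where
  braid : ∀ i, i + 1 < N →
    f (.of i) * f (.of (i + 1)) * f (.of i) = f (.of (i + 1)) * f (.of i) * f (.of (i + 1))
  comm : ∀ i j, i + 2 ≤ j → Commute (f (.of i)) (f (.of j))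

namespace SatisfiesBraidRels

variable {G : Type*} [Group G] {f : FreeGroup ℕ →* G} {N : ℕ}

theorem commute_descWord (h : SatisfiesBraidRels f N) {k j : ℕ} (hkj : k + 1 ≤ j) :
    Commute (f (descWord k)) (f (.of j)) := by
  induction k with
  | zero => simp [descWord]
  | succ k ih =>
    rw [descWord, map_mul]
    exact (h.comm k j (by omega)).mul_left (ih (by omega))

theorem commute_deltaWord (h : SatisfiesBraidRels f N) {k j : ℕ} (hkj : k ≤ j) :
    Commute (f (deltaWord k)) (f (.of j)) := by
  induction k with
  | zero => simp [deltaWord]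
  | succ k ih =>
    rw [deltaWord_succ, map_mul]
    exact (ih (by omega)).mul_left (h.commute_descWord hkj)

theorem descWord_mul_of (h : SatisfiesBraidRels f N) {k i : ℕ} (hk : k ≤ N) (hi : i + 1 < k) :
    f (descWord k) * f (.of (i + 1)) = f (.of i) * f (descWord k) := by
  induction k with
  | zero => omega
  | succ k ih =>
    rcases Nat.lt_or_ge (i + 1) k with hik | hik
    · rw [descWord, map_mul, mul_assoc, ih (by omega) hik, ← mul_assoc, ← mul_assoc,
        (h.comm i k (by omega)).eq]
    · obtain rfl : k = i + 1 := by omega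
      rw [descWord, descWord, map_mul, map_mul, mul_assoc, mul_assoc,
        (h.commute_descWord le_rfl).eq, ← mul_assoc, ← mul_assoc, ← h.braid i (by omega)]
      simp only [mul_assoc]

theorem descWord_mul_descWord (h : SatisfiesBraidRels f N) {m j : ℕ} (hm : m ≤ N) (hj : j < m) :
    f (descWord m) * f (descWord (j + 1)) =
      f (descWord j) * f (descWord m) * f (.of 0) := by
  induction j with
  | zero => simp [descWord]
  | succ j ih =>
    rw [descWord, map_mul, ← mul_assoc, h.descWord_mul_of hm hj, mul_assoc, ih (by omega),
      descWord, map_mul]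
    simp only [mul_assoc]

/-- Conjugation by the half twist on `k` strands exchanges `σ_{i+1}` and `σ_{k-1-i}`. -/
theorem deltaWord_mul_of (h : SatisfiesBraidRels f N) {k i j : ℕ} (hk : k ≤ N + 1)
    (hij : i + j + 2 = k) :
    f (deltaWord k) * f (.of i) = f (.of j) * f (deltaWord k) := by
  induction k generalizing i j with
  | zero => omega
  | succ k ih =>
    cases i with
    | succ i =>
      rw [deltaWord_succ, map_mul, mul_assoc, h.descWord_mul_of (by omega) (by omega),
        ← mul_assoc, ih (j := j) (by omega) (by omega), mul_assoc]
    | zero =>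
      obtain rfl : k = j + 1 := by omega
      have key : f (descWord j) * f (descWord (j + 1)) * f (.of 0) =
          f (.of j) * f (descWord j) * f (descWord (j + 1)) := by
        rw [← h.descWord_mul_descWord (by omega) (by omega), ← map_mul f (.of j), ← descWord]
      rw [deltaWord_succ, deltaWord_succ, map_mul, map_mul]
      calc _ = f (deltaWord j) * (f (descWord j) * f (descWord (j + 1)) * f (.of 0)) := by
            simp only [mul_assoc]
        _ = f (deltaWord j) * f (.of j) * (f (descWord j) * f (descWord (j + 1))) := by
            rw [key]; simp only [mul_assoc]
        _ = _ := by
            rw [(h.commute_deltaWord le_rfl).eq]; simp only [mul_assoc]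

/-- The full twist on `k` strands commutes with the generators of `B_k`. -/
theorem commute_deltaWord_sq (h : SatisfiesBraidRels f N) {k i : ℕ} (hk : k ≤ N + 1)
    (hi : i + 2 ≤ k) : Commute (f (deltaWord k) ^ 2) (f (.of i)) := by
  obtain ⟨j, rfl⟩ := Nat.exists_eq_add_of_le hi
  rw [commute_iff_eq, sq, mul_assoc, h.deltaWord_mul_of (j := j) hk (by omega), ← mul_assoc,
    h.deltaWord_mul_of (j := i) hk (by omega), mul_assoc]

theorem commute_deltaWord_sq_deltaWord (h : SatisfiesBraidRels f N) {k m : ℕ} (hk : k ≤ N + 1)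
    (hm : m ≤ k) : Commute (f (deltaWord k) ^ 2) (f (deltaWord m)) := by
  have desc : ∀ l, l < k → Commute (f (deltaWord k) ^ 2) (f (descWord l)) := by
    intro l hl
    induction l with
    | zero => simp [descWord]
    | succ l ih =>
      rw [descWord, map_mul]
      exact (h.commute_deltaWord_sq hk (by omega)).mul_right (ih (by omega))
  induction m with
  | zero => simp [deltaWord]
  | succ m ih =>
    rw [deltaWord_succ, map_mul]
    exact (ih (by omega)).mul_right (desc m (by omega))

theorem deltaWord_succ_eq_ascWord_mul (h : SatisfiesBraidRels f N) (m : ℕ) :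
    f (deltaWord (m + 1)) = f (ascWord m) * f (deltaWord m) := by
  induction m with
  | zero => simp [deltaWord, ascWord]
  | succ m ih =>
    rw [deltaWord_succ, map_mul, ih, descWord, map_mul, ascWord, map_mul, mul_assoc,
      ← mul_assoc (f (deltaWord m)), (h.commute_deltaWord le_rfl).eq, ← ih, deltaWord_succ, map_mul]
    simp only [mul_assoc]

theorem deltaWord_succ_sq (h : SatisfiesBraidRels f N) (m : ℕ) :
    f (deltaWord (m + 1)) ^ 2 =
      f (deltaWord m) * (f (descWord m) * f (ascWord m)) * f (deltaWord m) := by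
  rw [sq]
  nth_rw 2 [h.deltaWord_succ_eq_ascWord_mul]
  rw [deltaWord_succ, map_mul]
  simp only [mul_assoc]

/-- The product of the full twists on `m` and `m + 2` strands, in terms of the full twist on
`m + 1` strands and `σ_{m+1}`. -/
theorem of_mul_deltaWord_sq_mul_self (h : SatisfiesBraidRels f N) {m : ℕ} (hm : m < N) :
    f (.of m) * f (deltaWord (m + 1)) ^ 2 * f (.of m) * f (deltaWord (m + 1)) ^ 2 =
      f (deltaWord (m + 2)) ^ 2 * f (deltaWord m) ^ 2 := by
  have hA := h.deltaWord_succ_sq m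
  have hB := h.deltaWord_succ_sq (m + 1)
  rw [descWord, ascWord, map_mul, map_mul] at hB
  have c1 := h.commute_deltaWord_sq_deltaWord (k := m + 1) (m := m) (by omega) (by omega)
  have c2 := h.commute_deltaWord_sq_deltaWord (k := m + 2) (m := m + 1) (by omega) (by omega)
  have c3 := (h.commute_deltaWord (k := m) le_rfl).pow_left 2
  have c4 := (c1.pow_right 2)
  generalize f (deltaWord (m + 2)) ^ 2 = T at *
  generalize f (deltaWord (m + 1)) = D at *
  generalize f (deltaWord m) = E at *
  generalize f (.of m) = s at *
  have hX : f (descWord m) * f (ascWord m) = D ^ 2 * (E ^ 2)⁻¹ := by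
    rw [eq_mul_inv_iff_mul_eq, ← mul_right_inj E, ← c1.eq, hA]
    simp only [sq, mul_assoc]
  have hT : T = s * (D ^ 2 * (E ^ 2)⁻¹) * s * D ^ 2 := by
    rw [← mul_right_inj D, ← c2.eq, ← hX, hB]
    simp only [sq, mul_assoc]
  rw [hT]
  have e : (E ^ 2)⁻¹ * s * D ^ 2 * E ^ 2 = s * D ^ 2 := by
    rw [mul_assoc, c4.eq, mul_assoc, ← mul_assoc s, ← c3.eq]
    group
  calc _ = s * D ^ 2 * (s * D ^ 2) := by simp only [mul_assoc]
    _ = s * D ^ 2 * ((E ^ 2)⁻¹ * s * D ^ 2 * E ^ 2) := by rw [e]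
    _ = _ := by simp only [mul_assoc]

theorem of_deltaWord_sq_relation (h : SatisfiesBraidRels f N) {m : ℕ} (hm : m < N) :
    f (.of m) * f (deltaWord (m + 1)) ^ 2 * f (.of m) * f (deltaWord (m + 1)) ^ 2 =
      f (deltaWord (m + 1)) ^ 2 * f (.of m) * f (deltaWord (m + 1)) ^ 2 * f (.of m) := by
  have c : Commute (f (deltaWord (m + 2)) ^ 2 * f (deltaWord m) ^ 2) (f (.of m)) :=
    (h.commute_deltaWord_sq (by omega) le_rfl).mul_left
      ((h.commute_deltaWord le_rfl).pow_left 2)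
  rw [← h.of_mul_deltaWord_sq_mul_self hm] at c
  rw [← mul_right_inj (f (.of m)), ← c.eq]
  simp only [mul_assoc]

end SatisfiesBraidRels

theorem toBraid_of_of_lt {n k : ℕ} (h : k < n) : toBraid n (.of k) = braidGen ⟨k, h⟩ := by
  simp [toBraid, h]

theorem toBraid_satisfiesBraidRels (n : ℕ) : SatisfiesBraidRels (toBraid n) n where
  braid i hi := by
    rw [toBraid_of_of_lt hi, toBraid_of_of_lt (Nat.lt_of_succ_lt hi)]
    exact PresentedGroup.mk_eq_mk_of_mul_inv_mem (rels := braidRels n) (Or.inl ⟨_, _, rfl, rfl⟩)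
  comm i j hij := by
    by_cases hj : j < n
    · rw [toBraid_of_of_lt hj, toBraid_of_of_lt (k := i) (by omega)]
      exact PresentedGroup.mk_eq_mk_of_mul_inv_mem (rels := braidRels n) (Or.inr ⟨_, _, hij, rfl⟩)
    · simp [toBraid, hj]

/-- For every `n ≥ 2`, in `B_{n+1}` the elements `σ_n` and `Δ_n²` satisfy
`σ_n Δ_n² σ_n Δ_n² = Δ_n² σ_n Δ_n² σ_n`; consequently there is a group homomorphism
`AB_2 → B_{n+1}` sending `τ ↦ Δ_n²` and `σ ↦ σ_n`. -/
theorem stmt1 (n : ℕ) (hn : 2 ≤ n) (s D : BraidGroup n)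
    (hs : s = braidGen ⟨n - 1, by omega⟩) (hD : D = deltaElem n n) :
    s * D ^ 2 * s * D ^ 2 = D ^ 2 * s * D ^ 2 * s ∧
    ∃ f : AffineBraid2 →* BraidGroup n,
      f (PresentedGroup.of true) = s ∧ f (PresentedGroup.of false) = D ^ 2 := by
  have rel : s * D ^ 2 * s * D ^ 2 = D ^ 2 * s * D ^ 2 * s := by
    obtain ⟨m, rfl⟩ : ∃ m, n = m + 1 := ⟨n - 1, by omega⟩
    have hs' : s = toBraid (m + 1) (.of m) := by rw [hs, toBraid_of_of_lt m.lt_succ_self]; rfl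
    rw [hs', hD, deltaElem]
    exact (toBraid_satisfiesBraidRels (m + 1)).of_deltaWord_sq_relation m.lt_succ_self
  refine ⟨rel, PresentedGroup.toGroup (f := fun b => if b then s else D ^ 2) ?_, ?_, ?_⟩
  · rintro r rfl
    rw [map_mul, map_inv, mul_inv_eq_one]
    simpa using rel
  · simp [PresentedGroup.toGroup.of]
  · simp [PresentedGroup.toGroup.of]
end

section
/- Let n ≥ 2 and let ρ : B_{n+1} → End(W) be a representation on a finite-dimensional complex vector space W such that ρ(Δ_{n+1}²) = α·id_W for some α ∈ ℂ. Let p ∈ End(W) be an idempotent lying in the linear span of {ρ(g) : g ∈ B_{n−1}} which is minimal, i.e. pρ(g)p ∈ ℂ·p for every g ∈ B_{n−1}, and suppose ρ(Δ_{n−1}²)p = α'·p for some α' ∈ ℂ. Then p commutes with ρ(σ_n) and with ρ(Δ_n²), so the subspace pW is invariant under A := ρ(σ_n) and T := ρ(Δ_n²), and on pW one has ATAT = TATA = α'α·id_{pW}. -/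
/-- The subgroup `B_{n-1}` of `B_{n+1}`, generated by `σ_1, …, σ_{n-2}`. -/
def braidSub (n : ℕ) : Subgroup (BraidGroup n) :=
  Subgroup.closure { g | ∃ i : Fin n, i.val < n - 2 ∧ g = braidGen i }

/-- The image of the letter `k` in the braid group: `σ_{k+1}`, or `1` if `k` is out of range. -/
def braidLetter (n k : ℕ) : BraidGroup n := toBraid n (FreeGroup.of k)

/-- The element `σ_k ⋯ σ_1`. -/
def descElem (n k : ℕ) : BraidGroup n := toBraid n (descWord k)

/-- The element `σ_1 ⋯ σ_k`. -/
def ascElem (n k : ℕ) : BraidGroup n := toBraid n (ascWord k)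

/-- The Jucys–Murphy element `σ_k ⋯ σ_1 σ_1 ⋯ σ_k`. -/
def jucysMurphyElem (n k : ℕ) : BraidGroup n := descElem n k * ascElem n k

lemma braidLetter_of_lt {n k : ℕ} (h : k < n) : braidLetter n k = braidGen ⟨k, h⟩ := by
  simp [braidLetter, toBraid, h]

lemma braidLetter_of_le {n k : ℕ} (h : n ≤ k) : braidLetter n k = 1 := by
  simp [braidLetter, toBraid, Nat.not_lt.mpr h]

lemma braidLetter_braid {n i : ℕ} (h : i + 1 < n) :
    braidLetter n i * braidLetter n (i + 1) * braidLetter n i =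
      braidLetter n (i + 1) * braidLetter n i * braidLetter n (i + 1) := by
  rw [braidLetter_of_lt h, braidLetter_of_lt (Nat.lt_of_succ_lt h)]
  have key := PresentedGroup.one_of_mem (rels := braidRels n)
    (Or.inl ⟨⟨i, Nat.lt_of_succ_lt h⟩, ⟨i + 1, h⟩, rfl, rfl⟩)
  rw [map_mul, map_inv, mul_inv_eq_one] at key
  simp only [map_mul] at key
  exact key

lemma braidLetter_commute {n i j : ℕ} (h : i + 2 ≤ j) :
    Commute (braidLetter n i) (braidLetter n j) := by
  rcases lt_or_ge j n with hj | hj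
  · have hi : i < n := by omega
    rw [braidLetter_of_lt hj, braidLetter_of_lt hi]
    have key := PresentedGroup.one_of_mem (rels := braidRels n)
      (Or.inr ⟨⟨i, hi⟩, ⟨j, hj⟩, h, rfl⟩)
    rw [map_mul, map_inv, mul_inv_eq_one] at key
    simp only [map_mul] at key
    exact key
  · rw [braidLetter_of_le hj]
    exact Commute.one_right _

lemma descElem_zero (n : ℕ) : descElem n 0 = 1 := map_one _

lemma descElem_succ (n k : ℕ) : descElem n (k + 1) = braidLetter n k * descElem n k :=
  map_mul _ _ _

lemma ascElem_zero (n : ℕ) : ascElem n 0 = 1 := map_one _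

lemma ascElem_succ (n k : ℕ) : ascElem n (k + 1) = ascElem n k * braidLetter n k :=
  map_mul _ _ _

lemma deltaElem_zero (n : ℕ) : deltaElem n 0 = 1 := map_one _

lemma deltaElem_one (n : ℕ) : deltaElem n 1 = 1 := map_one _

lemma deltaElem_succ (n k : ℕ) : deltaElem n (k + 1) = deltaElem n k * descElem n k := by
  cases k with
  | zero => simp [deltaElem_zero, deltaElem_one, descElem_zero]
  | succ k => exact map_mul _ _ _

section Commute

variable {n k : ℕ} {x : BraidGroup n}

lemma commute_descElem (h : ∀ i < k, Commute x (braidLetter n i)) :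
    Commute x (descElem n k) := by
  induction k with
  | zero => simp [descElem_zero]
  | succ k ih =>
    rw [descElem_succ]
    exact (h k k.lt_succ_self).mul_right (ih fun i hi => h i (by omega))

lemma commute_ascElem (h : ∀ i < k, Commute x (braidLetter n i)) :
    Commute x (ascElem n k) := by
  induction k with
  | zero => simp [ascElem_zero]
  | succ k ih =>
    rw [ascElem_succ]
    exact (ih fun i hi => h i (by omega)).mul_right (h k k.lt_succ_self)

lemma commute_jucysMurphyElem (h : ∀ i < k, Commute x (braidLetter n i)) :
    Commute x (jucysMurphyElem n k) :=
  (commute_descElem h).mul_right (commute_ascElem h)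

lemma commute_deltaElem (h : ∀ i, i + 1 < k → Commute x (braidLetter n i)) :
    Commute x (deltaElem n k) := by
  induction k with
  | zero => simp [deltaElem_zero]
  | succ k ih =>
    rw [deltaElem_succ]
    exact (ih fun i hi => h i (by omega)).mul_right
      (commute_descElem fun i hi => h i (by omega))

end Commute

lemma descElem_mul_braidLetter {n k i : ℕ} (hk : k ≤ n) (hi : i + 1 < k) :
    descElem n k * braidLetter n (i + 1) = braidLetter n i * descElem n k := by
  induction k with
  | zero => omega
  | succ k ih =>
    rcases Nat.lt_or_ge (i + 1) k with h | h
    · rw [descElem_succ, mul_assoc, ih (by omega) h, ← mul_assoc, ← mul_assoc,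
        (braidLetter_commute h).eq]
    · obtain rfl : k = i + 1 := by omega
      have hc : Commute (braidLetter n (i + 1)) (descElem n i) :=
        commute_descElem fun j hj => (braidLetter_commute (by omega)).symm
      rw [descElem_succ, descElem_succ, mul_assoc, mul_assoc, ← hc.eq]
      simp only [← mul_assoc]
      rw [braidLetter_braid (by omega)]

lemma braidLetter_mul_ascElem {n k i : ℕ} (hk : k ≤ n) (hi : i + 1 < k) :
    braidLetter n (i + 1) * ascElem n k = ascElem n k * braidLetter n i := by
  induction k with
  | zero => omega
  | succ k ih =>
    rcases Nat.lt_or_ge (i + 1) k with h | h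
    · rw [ascElem_succ, ← mul_assoc, ih (by omega) h, mul_assoc, mul_assoc,
        (braidLetter_commute h).eq]
    · obtain rfl : k = i + 1 := by omega
      have hc : Commute (braidLetter n (i + 1)) (ascElem n i) :=
        commute_ascElem fun j hj => (braidLetter_commute (by omega)).symm
      rw [ascElem_succ, ascElem_succ, ← mul_assoc, ← mul_assoc, hc.eq]
      simp only [mul_assoc]
      simp only [← mul_assoc (braidLetter n _)]
      rw [braidLetter_braid (by omega)]

lemma braidLetter_commute_jucysMurphyElem {n k i : ℕ} (hk : k ≤ n) (hi : i + 1 < k) :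
    Commute (braidLetter n i) (jucysMurphyElem n k) := by
  rw [Commute, SemiconjBy, jucysMurphyElem, ← mul_assoc, ← descElem_mul_braidLetter hk hi,
    mul_assoc, braidLetter_mul_ascElem hk hi, mul_assoc]

lemma jucysMurphyElem_succ (n k : ℕ) :
    jucysMurphyElem n (k + 1) = braidLetter n k * jucysMurphyElem n k * braidLetter n k := by
  simp only [jucysMurphyElem, descElem_succ, ascElem_succ, mul_assoc]

lemma braidLetter_commute_deltaElem (n k : ℕ) :
    Commute (braidLetter n k) (deltaElem n k) :=
  commute_deltaElem fun _ hi => (braidLetter_commute (by omega)).symm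

lemma deltaElem_succ' (n k : ℕ) : deltaElem n (k + 1) = ascElem n k * deltaElem n k := by
  induction k with
  | zero => simp [deltaElem_zero, deltaElem_one, ascElem_zero]
  | succ k ih =>
    rw [deltaElem_succ, descElem_succ, ih, mul_assoc, ← mul_assoc (deltaElem n k),
      ← (braidLetter_commute_deltaElem n k).eq, mul_assoc (braidLetter n k), ← deltaElem_succ,
      ih, ascElem_succ, mul_assoc]

lemma deltaElem_commute_jucysMurphyElem {n k : ℕ} (hk : k ≤ n) :
    Commute (deltaElem n k) (jucysMurphyElem n k) :=
  (commute_deltaElem fun _ hi => (braidLetter_commute_jucysMurphyElem hk hi).symm).symm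

lemma deltaElem_succ_sq {n k : ℕ} (hk : k ≤ n) :
    deltaElem n (k + 1) ^ 2 = deltaElem n k ^ 2 * jucysMurphyElem n k := by
  have hc := (deltaElem_commute_jucysMurphyElem hk).eq
  calc deltaElem n (k + 1) ^ 2
      = deltaElem n k * descElem n k * (ascElem n k * deltaElem n k) := by
        rw [sq, ← deltaElem_succ, ← deltaElem_succ']
    _ = deltaElem n k * (jucysMurphyElem n k * deltaElem n k) := by
        simp only [jucysMurphyElem, mul_assoc]
    _ = deltaElem n k ^ 2 * jucysMurphyElem n k := by rw [← hc, sq, mul_assoc]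

lemma braidLetter_commute_deltaElem_sq {n k i : ℕ} (hk : k ≤ n + 1) (hi : i + 1 < k) :
    Commute (braidLetter n i) (deltaElem n k ^ 2) := by
  induction k with
  | zero => omega
  | succ k ih =>
    rcases Nat.lt_or_ge (i + 1) k with h | h
    · rw [deltaElem_succ_sq (by omega)]
      exact (ih (by omega) h).mul_right (braidLetter_commute_jucysMurphyElem (by omega) h)
    · obtain rfl : k = i + 1 := by omega
      rw [deltaElem_succ_sq (by omega), deltaElem_succ_sq (by omega), mul_assoc]
      refine ((braidLetter_commute_deltaElem n i).pow_right 2).mul_right ?_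
      have hc : Commute (jucysMurphyElem n (i + 1)) (jucysMurphyElem n i) :=
        commute_jucysMurphyElem fun j hj =>
          (braidLetter_commute_jucysMurphyElem (by omega) (by omega)).symm
      rw [Commute, SemiconjBy, ← hc.eq, mul_assoc (jucysMurphyElem n (i + 1)), hc.eq,
        jucysMurphyElem_succ]
      simp only [mul_assoc]

/-- With `A = σ_{k+1}` and `T = Δ_{k+1}²`, one has `ATAT = Δ_k² Δ_{k+2}²`. -/
lemma braidLetter_mul_deltaElem_sq {n k : ℕ} (hk : k + 1 ≤ n) :
    braidLetter n k * deltaElem n (k + 1) ^ 2 * braidLetter n k * deltaElem n (k + 1) ^ 2 =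
      deltaElem n k ^ 2 * deltaElem n (k + 2) ^ 2 := by
  have hA := ((braidLetter_commute_deltaElem n k).pow_right 2).eq
  have hY := ((deltaElem_commute_jucysMurphyElem hk).pow_left 2).eq
  calc _ = deltaElem n k ^ 2 * jucysMurphyElem n (k + 1) * deltaElem n (k + 1) ^ 2 := by
        congr 1
        rw [deltaElem_succ_sq (by omega), jucysMurphyElem_succ, ← mul_assoc, hA]
        simp only [mul_assoc]
    _ = _ := by rw [mul_assoc, ← hY, ← deltaElem_succ_sq hk]

lemma deltaElem_sq_mul_braidLetter {n k : ℕ} (hk : k + 1 ≤ n) :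
    deltaElem n (k + 1) ^ 2 * braidLetter n k * deltaElem n (k + 1) ^ 2 * braidLetter n k =
      deltaElem n k ^ 2 * deltaElem n (k + 2) ^ 2 := by
  have hc : Commute (braidLetter n k) (deltaElem n k ^ 2 * deltaElem n (k + 2) ^ 2) :=
    ((braidLetter_commute_deltaElem n k).pow_right 2).mul_right
      (braidLetter_commute_deltaElem_sq (by omega) (by omega))
  rw [← mul_right_inj (braidLetter n k), hc.eq, ← braidLetter_mul_deltaElem_sq hk]
  simp only [mul_assoc]

/-- An element of the braid group commuting with `σ_1, …, σ_{n-2}` commutes, in any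
representation, with the span of the image of `B_{n-1}`. -/
lemma commute_of_mem_span_braidSub {n : ℕ} {R E : Type*} [CommSemiring R] [Semiring E]
    [Algebra R E] (ρ : BraidGroup n →* E) {p : E}
    (hp : p ∈ Submodule.span R ((fun g => ρ g) '' (braidSub n : Set (BraidGroup n))))
    {x : BraidGroup n} (hx : ∀ i < n - 2, Commute x (braidLetter n i)) :
    Commute p (ρ x) := by
  have hsub : ∀ g ∈ braidSub n, Commute g x := by
    have : braidSub n ≤ Subgroup.centralizer {x} := by
      refine (Subgroup.closure_le _).mpr ?_
      rintro _ ⟨i, hi, rfl⟩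
      rw [SetLike.mem_coe, Subgroup.mem_centralizer_singleton_iff, ← braidLetter_of_lt i.isLt]
      exact (hx i hi).eq.symm
    exact fun g hg => Subgroup.mem_centralizer_singleton_iff.mp (this hg)
  induction hp using Submodule.span_induction with
  | mem _ h =>
    obtain ⟨g, hg, rfl⟩ := h
    exact (hsub g hg).map ρ
  | zero => exact Commute.zero_left _
  | add _ _ _ _ h₁ h₂ => exact h₁.add_left h₂
  | smul c _ _ h => exact h.smul_left c

/-- Let `n ≥ 2` and `ρ : B_{n+1} → End(W)` a representation on a finite-dimensional
complex vector space with `ρ(Δ_{n+1}²) = α·id`.  If `p` is a minimal idempotent in the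
linear span of `ρ(B_{n-1})` with `ρ(Δ_{n-1}²) p = α' p`, then `p` commutes with
`A = ρ(σ_n)` and `T = ρ(Δ_n²)`, the subspace `pW` is invariant under `A` and `T`, and on
`pW` one has `ATAT = TATA = α'α·id`. -/
theorem stmt2 (n : ℕ) (hn : 2 ≤ n)
    (W : Type) [AddCommGroup W] [Module ℂ W] [FiniteDimensional ℂ W]
    (ρ : BraidGroup n →* Module.End ℂ W) (α α' : ℂ)
    (hα : ρ ((deltaElem n (n + 1)) ^ 2) = α • (1 : Module.End ℂ W))
    (p : Module.End ℂ W) (hp : p * p = p)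
    (hspan : p ∈ Submodule.span ℂ ((fun g => ρ g) '' (braidSub n : Set (BraidGroup n))))
    (hmin : ∀ g ∈ braidSub n, ∃ c : ℂ, p * ρ g * p = c • p)
    (hα' : ρ ((deltaElem n (n - 1)) ^ 2) * p = α' • p)
    (A T : Module.End ℂ W)
    (hA : A = ρ (braidGen ⟨n - 1, by omega⟩))
    (hT : T = ρ ((deltaElem n n) ^ 2)) :
    p * A = A * p ∧ p * T = T * p ∧
    (∀ w : W, A (p w) ∈ LinearMap.range p) ∧
    (∀ w : W, T (p w) ∈ LinearMap.range p) ∧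
    (∀ w : W, (A * T * A * T) (p w) = (α' * α) • p w) ∧
    (∀ w : W, (T * A * T * A) (p w) = (α' * α) • p w) := by
  obtain ⟨m, rfl⟩ : ∃ m, n = m + 1 := ⟨n - 1, by omega⟩
  have hA' : A = ρ (braidLetter (m + 1) m) := by
    rw [hA, braidLetter_of_lt m.lt_succ_self]
    rfl
  have cA : Commute p A := by
    rw [hA']
    exact commute_of_mem_span_braidSub ρ hspan fun i hi =>
      (braidLetter_commute (by omega)).symm
  have cT : Commute p T := by
    rw [hT]
    exact commute_of_mem_span_braidSub ρ hspan fun i hi =>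
      (braidLetter_commute_deltaElem_sq (by omega) (by omega)).symm
  have scalar : ρ (deltaElem (m + 1) m ^ 2 * deltaElem (m + 1) (m + 2) ^ 2) * p =
      (α' * α) • p := by
    rw [map_mul, hα, mul_smul_comm, mul_one, smul_mul_assoc]
    rw [Nat.add_sub_cancel] at hα'
    rw [hα', smul_smul, mul_comm]
  refine ⟨cA.eq, cT.eq, fun w => ⟨A w, LinearMap.congr_fun cA.eq w⟩,
    fun w => ⟨T w, LinearMap.congr_fun cT.eq w⟩, fun w => ?_, fun w => ?_⟩
  · rw [← braidLetter_mul_deltaElem_sq le_rfl] at scalar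
    simp only [map_mul ρ, ← hA', ← hT] at scalar
    exact LinearMap.congr_fun scalar w
  · rw [← deltaElem_sq_mul_braidLetter le_rfl] at scalar
    simp only [map_mul ρ, ← hA', ← hT] at scalar
    exact LinearMap.congr_fun scalar w
end

section
/- Let A be an invertible n×n complex matrix satisfying (A − λ_1 I)(A − λ_2 I)(A − λ_3 I) = 0, where λ_3 ≠ 0 and λ_3 ∉ {λ_1, λ_2}, and set P = (A − λ_1 I)(A − λ_2 I)/((λ_3 − λ_1)(λ_3 − λ_2)). Then A + λ_1λ_2 A^{−1} = (λ_1 + λ_2)I + λ_3^{−1}(λ_3 − λ_1)(λ_3 − λ_2)P. If moreover T = diag(x_1, …, x_n) with all x_r ≠ 0 and ATAT = TATA = δ·I with δ ≠ 0, then for all indices r, s: (δ + λ_1λ_2 x_r x_s)·A_{rs} = δ(λ_1 + λ_2)·δ_{rs} + δ·λ_3^{−1}(λ_3 − λ_1)(λ_3 − λ_2)·P_{rs}, where δ_{rs} is the Kronecker delta. -/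
/-- Let `A` be an invertible `n×n` complex matrix with
`(A - λ₁I)(A - λ₂I)(A - λ₃I) = 0`, `λ₃ ≠ 0`, `λ₃ ∉ {λ₁, λ₂}`, and let
`P = (A - λ₁I)(A - λ₂I)/((λ₃-λ₁)(λ₃-λ₂))`.  Then
`A + λ₁λ₂ A⁻¹ = (λ₁+λ₂)I + λ₃⁻¹(λ₃-λ₁)(λ₃-λ₂) P`.  If moreover `T = diag(x)` with all
`x_r ≠ 0` and `ATAT = TATA = δ·I` with `δ ≠ 0`, then for all `r, s`:
`(δ + λ₁λ₂ x_r x_s) A_{rs} = δ(λ₁+λ₂) δ_{rs} + δ λ₃⁻¹ (λ₃-λ₁)(λ₃-λ₂) P_{rs}`. -/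
theorem stmt5 (n : ℕ) (A : Matrix (Fin n) (Fin n) ℂ) (hA : IsUnit A)
    (l1 l2 l3 : ℂ) (hl3 : l3 ≠ 0) (h31 : l3 ≠ l1) (h32 : l3 ≠ l2)
    (hmin : (A - l1 • (1 : Matrix (Fin n) (Fin n) ℂ)) * (A - l2 • 1) * (A - l3 • 1) = 0)
    (P : Matrix (Fin n) (Fin n) ℂ)
    (hP : P = ((l3 - l1) * (l3 - l2))⁻¹ • ((A - l1 • 1) * (A - l2 • 1))) :
    A + (l1 * l2) • A⁻¹ = (l1 + l2) • 1 + (l3⁻¹ * (l3 - l1) * (l3 - l2)) • P ∧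
    ∀ (T : Matrix (Fin n) (Fin n) ℂ) (x : Fin n → ℂ) (δ : ℂ),
      T = Matrix.diagonal x → (∀ r, x r ≠ 0) → δ ≠ 0 →
      A * T * A * T = δ • (1 : Matrix (Fin n) (Fin n) ℂ) →
      T * A * T * A = δ • (1 : Matrix (Fin n) (Fin n) ℂ) →
      ∀ r s, (δ + l1 * l2 * x r * x s) * A r s =
        δ * (l1 + l2) * (if r = s then 1 else 0) +
          δ * l3⁻¹ * (l3 - l1) * (l3 - l2) * P r s := by
  have hdet : IsUnit A.det := (Matrix.isUnit_iff_isUnit_det A).mp hA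
  have hAB : A * A⁻¹ = 1 := Matrix.mul_nonsing_inv A hdet
  have hd1 : l3 - l1 ≠ 0 := sub_ne_zero.mpr h31
  have hd2 : l3 - l2 ≠ 0 := sub_ne_zero.mpr h32
  have main : A + (l1 * l2) • A⁻¹ =
      (l1 + l2) • 1 + (l3⁻¹ * (l3 - l1) * (l3 - l2)) • P := by
    have hscale : (l3⁻¹ * (l3 - l1) * (l3 - l2)) • P =
        l3⁻¹ • ((A - l1 • 1) * (A - l2 • 1)) := by
      rw [hP, smul_smul]
      congr 1
      field_simp
    have hQA : (A - l1 • 1) * (A - l2 • 1) * A = l3 • ((A - l1 • 1) * (A - l2 • 1)) := by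
      rw [mul_sub, mul_smul_comm, mul_one, sub_eq_zero] at hmin
      exact hmin
    have hQinv : (A - l1 • 1) * (A - l2 • 1) * A⁻¹ =
        l3⁻¹ • ((A - l1 • 1) * (A - l2 • 1)) := by
      rw [eq_inv_smul_iff₀ hl3, ← smul_mul_assoc, ← hQA, mul_assoc _ A, hAB, mul_one]
    have hexpand : (A - l1 • 1) * (A - l2 • 1) * A⁻¹ =
        A - (l1 + l2) • 1 + (l1 * l2) • A⁻¹ := by
      rw [mul_assoc, sub_mul A (l2 • 1), hAB, smul_mul_assoc, one_mul, sub_mul, mul_sub,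
        mul_one, mul_smul_comm, hAB, smul_mul_assoc, one_mul]
      module
    rw [hscale, ← hQinv, hexpand]
    abel
  refine ⟨main, ?_⟩
  intro T x δ hT _ hδ hATAT _ r s
  have hinv : δ • A⁻¹ = T * A * T := by
    rw [← mul_one (A⁻¹), ← mul_smul_comm, ← hATAT, mul_assoc A T A, mul_assoc A (T * A) T,
      ← mul_assoc, Matrix.nonsing_inv_mul A hdet, one_mul]
  have hentry : δ * A⁻¹ r s = x r * A r s * x s := by
    simpa [hT, Matrix.mul_diagonal, Matrix.diagonal_mul] using congrFun (congrFun hinv r) s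
  have hrs := congrFun (congrFun main r) s
  simp only [Matrix.add_apply, Matrix.smul_apply, smul_eq_mul, Matrix.one_apply] at hrs
  linear_combination δ * hrs - l1 * l2 * hentry
end

section
/- Let T = diag(x, y) be a 2×2 complex diagonal matrix with x ≠ y, and let A be a 2×2 complex matrix which is not diagonal, satisfies (A − λ_1 I)(A − λ_2 I) = 0 with λ_1 ≠ λ_2, and satisfies the braid relation ATAT = TATA. Then the eigenprojection P := (A − λ_1 I)/(λ_2 − λ_1) has diagonal entries P_{11} = −(λ_1 x + λ_2 y)/((x − y)(λ_2 − λ_1)) and P_{22} = (λ_2 x + λ_1 y)/((x − y)(λ_2 − λ_1)), and the off-diagonal entries of A satisfy A_{12}A_{21} = −(λ_1 x + λ_2 y)(λ_2 x + λ_1 y)/(x − y)². In particular, if λ_1 x + λ_2 y ≠ 0 and λ_2 x + λ_1 y ≠ 0, then both off-diagonal entries of A are nonzero and the only subspaces of ℂ² invariant under both A and T are 0 and ℂ². -/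
/-- A subspace invariant under a diagonal `2×2` matrix with distinct diagonal entries and under a
matrix with nonzero off-diagonal entries is trivial. -/
theorem eq_bot_or_eq_top_of_invariant {K : Type*} [Field K] {x y : K} (hxy : x ≠ y)
    {A : Matrix (Fin 2) (Fin 2) K} (hb : A 0 1 ≠ 0) (hc : A 1 0 ≠ 0)
    {U : Submodule K (Fin 2 → K)} (hA : ∀ u ∈ U, A.mulVec u ∈ U)
    (hT : ∀ u ∈ U, (Matrix.diagonal ![x, y]).mulVec u ∈ U) : U = ⊥ ∨ U = ⊤ := by
  have hxy' : x - y ≠ 0 := sub_ne_zero.mpr hxy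
  have proj0 : ∀ u ∈ U, u 0 ≠ 0 → ![1, 0] ∈ U := fun u hu h0 => by
    have h := U.smul_mem ((x - y) * u 0)⁻¹ (U.sub_mem (hT u hu) (U.smul_mem y hu))
    convert h using 1
    ext i
    fin_cases i
    · simp [Matrix.vecHead, Matrix.vecTail]
      field_simp
    · simp [Matrix.vecHead, Matrix.vecTail]
  have proj1 : ∀ u ∈ U, u 1 ≠ 0 → ![0, 1] ∈ U := fun u hu h0 => by
    have h := U.smul_mem ((x - y) * u 1)⁻¹ (U.sub_mem (U.smul_mem x hu) (hT u hu))
    convert h using 1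
    ext i
    fin_cases i
    · simp [Matrix.vecHead, Matrix.vecTail]
    · simp [Matrix.vecHead, Matrix.vecTail]
      field_simp
  have top (h0 : ![1, 0] ∈ U) (h1 : ![0, 1] ∈ U) : U = ⊤ := by
    refine eq_top_iff.mpr fun v _ => ?_
    convert U.add_mem (U.smul_mem (v 0) h0) (U.smul_mem (v 1) h1) using 1
    ext i
    fin_cases i <;> simp
  refine or_iff_not_imp_left.mpr fun hU => ?_
  obtain ⟨u, hu, hu0⟩ := U.exists_mem_ne_zero_of_ne_bot hU
  by_cases h : u 0 = 0
  · have h1 : u 1 ≠ 0 := fun h1 => hu0 (by ext i; fin_cases i <;> simp [h, h1])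
    have he := proj1 u hu h1
    exact top (proj0 _ (hA _ he) (by simpa [Matrix.mulVec, dotProduct] using hb)) he
  · have he := proj0 u hu h
    exact top he (proj1 _ (hA _ he) (by simpa [Matrix.mulVec, dotProduct] using hc))

/-- Let `T = diag(x, y)` with `x ≠ y` and let `A` be a non-diagonal `2×2` complex matrix
with `(A - λ₁I)(A - λ₂I) = 0`, `λ₁ ≠ λ₂`, and `ATAT = TATA`.  Then the eigenprojection
`P = (A - λ₁I)/(λ₂ - λ₁)` has diagonal entries
`P₁₁ = -(λ₁x + λ₂y)/((x-y)(λ₂-λ₁))` and `P₂₂ = (λ₂x + λ₁y)/((x-y)(λ₂-λ₁))`, and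
`A₁₂A₂₁ = -(λ₁x + λ₂y)(λ₂x + λ₁y)/(x-y)²`.  If moreover `λ₁x + λ₂y ≠ 0` and
`λ₂x + λ₁y ≠ 0`, both off-diagonal entries of `A` are nonzero and the only subspaces of
`ℂ²` invariant under both `A` and `T` are `0` and `ℂ²`. -/
theorem stmt6 (x y : ℂ) (hxy : x ≠ y)
    (A T : Matrix (Fin 2) (Fin 2) ℂ) (hT : T = Matrix.diagonal ![x, y])
    (hnd : ¬ (A 0 1 = 0 ∧ A 1 0 = 0))
    (l1 l2 : ℂ) (hl : l1 ≠ l2)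
    (hmin : (A - l1 • (1 : Matrix (Fin 2) (Fin 2) ℂ)) * (A - l2 • 1) = 0)
    (hbraid : A * T * A * T = T * A * T * A)
    (P : Matrix (Fin 2) (Fin 2) ℂ) (hP : P = (l2 - l1)⁻¹ • (A - l1 • 1)) :
    P 0 0 = -(l1 * x + l2 * y) / ((x - y) * (l2 - l1)) ∧
    P 1 1 = (l2 * x + l1 * y) / ((x - y) * (l2 - l1)) ∧
    A 0 1 * A 1 0 = -((l1 * x + l2 * y) * (l2 * x + l1 * y)) / (x - y) ^ 2 ∧
    (l1 * x + l2 * y ≠ 0 → l2 * x + l1 * y ≠ 0 →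
      A 0 1 ≠ 0 ∧ A 1 0 ≠ 0 ∧
      ∀ U : Submodule ℂ (Fin 2 → ℂ),
        (∀ u ∈ U, A.mulVec u ∈ U) → (∀ u ∈ U, T.mulVec u ∈ U) →
        U = ⊥ ∨ U = ⊤) := by
  have hxy' : x - y ≠ 0 := sub_ne_zero.mpr hxy
  have hl' : l2 - l1 ≠ 0 := sub_ne_zero.mpr hl.symm
  have h00 := congrFun (congrFun hmin 0) 0
  have h01 := congrFun (congrFun hmin 0) 1
  have h10 := congrFun (congrFun hmin 1) 0
  have b01 := congrFun (congrFun hbraid 0) 1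
  have b10 := congrFun (congrFun hbraid 1) 0
  simp [Matrix.mul_apply, Fin.sum_univ_two, Matrix.one_apply] at h00 h01 h10
  simp [hT, Matrix.mul_apply, Fin.sum_univ_two, Matrix.diagonal_apply] at b01 b10
  obtain ⟨htr, htr'⟩ : A 0 0 + A 1 1 = l1 + l2 ∧ x * A 0 0 + y * A 1 1 = 0 := by
    rcases not_and_or.mp hnd with hb | hc
    · exact ⟨mul_left_cancel₀ hb (by linear_combination h01),
        mul_left_cancel₀ (mul_ne_zero hb hxy') (by linear_combination -b01)⟩
    · exact ⟨mul_left_cancel₀ hc (by linear_combination h10),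
        mul_left_cancel₀ (mul_ne_zero hc hxy') (by linear_combination b10)⟩
  have ha : A 0 0 - l1 = -(l1 * x + l2 * y) / (x - y) := by
    rw [eq_div_iff hxy']
    linear_combination htr' - y * htr
  have hd : A 1 1 - l1 = (l2 * x + l1 * y) / (x - y) := by
    rw [eq_div_iff hxy']
    linear_combination x * htr - htr'
  have hbc : A 0 1 * A 1 0 = -((l1 * x + l2 * y) * (l2 * x + l1 * y)) / (x - y) ^ 2 := by
    have h : A 0 1 * A 1 0 = (A 0 0 - l1) * (A 1 1 - l1) := by
      linear_combination h00 - (A 0 0 - l1) * htr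
    rw [h, ha, hd]
    field_simp
  refine ⟨?_, ?_, hbc, fun h1 h2 => ?_⟩
  · rw [hP]
    simp only [Matrix.smul_apply, Matrix.sub_apply, Matrix.one_apply_eq, smul_eq_mul, mul_one, ha]
    field_simp
  · rw [hP]
    simp only [Matrix.smul_apply, Matrix.sub_apply, Matrix.one_apply_eq, smul_eq_mul, mul_one, hd]
    field_simp
  have hne : A 0 1 * A 1 0 ≠ 0 := by
    rw [hbc]
    exact div_ne_zero (neg_ne_zero.mpr (mul_ne_zero h1 h2)) (pow_ne_zero 2 hxy')
  have hb := left_ne_zero_of_mul hne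
  have hc := right_ne_zero_of_mul hne
  exact ⟨hb, hc, fun U hA hTU =>
    eq_bot_or_eq_top_of_invariant hxy hb hc hA (by rwa [hT] at hTU)⟩
end

section
/- Let T = diag(x_1, …, x_n) be an n×n complex diagonal matrix with the x_r pairwise distinct and nonzero, and let A be an n×n complex matrix satisfying (A − λ_1 I)(A − λ_2 I) = 0 with λ_1λ_2 ≠ 0 and ATAT = TATA = δ·I with δ ≠ 0. Then: (a) if some one-dimensional subspace of ℂⁿ is invariant under both A and T, then δ = λ_i² x_r² for some i ∈ {1,2} and some r; (b) for each standard basis vector e_r, the subspace span{e_r, Ae_r} is invariant under both A and T; consequently every nonzero subspace of ℂⁿ invariant under both A and T contains an invariant subspace of dimension at most 2, and every irreducible invariant subspace has dimension at most 2. -/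
/-- A subspace `U ⊆ ℂⁿ` is invariant under the matrix `M` if `M U ⊆ U`. -/
def InvariantUnder {n : ℕ} (M : Matrix (Fin n) (Fin n) ℂ)
    (U : Submodule ℂ (Fin n → ℂ)) : Prop :=
  ∀ u ∈ U, M.mulVec u ∈ U

/-- A nonzero subspace invariant under a diagonal matrix with pairwise distinct entries contains
a standard basis vector. -/
lemma exists_single_mem_of_invariantUnder_diagonal {n : ℕ} {x : Fin n → ℂ}
    (hinj : Function.Injective x) {U : Submodule ℂ (Fin n → ℂ)}
    (hU : InvariantUnder (Matrix.diagonal x) U) (hne : U ≠ ⊥) :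
    ∃ r, (Pi.single r 1 : Fin n → ℂ) ∈ U := by
  have : Nontrivial U := Submodule.nontrivial_iff_ne_bot.mpr hne
  let f : Module.End ℂ U := (Matrix.mulVecLin (Matrix.diagonal x)).restrict hU
  obtain ⟨μ, hμ⟩ := Module.End.exists_eigenvalue f
  obtain ⟨u, hu⟩ := hμ.exists_hasEigenvector
  have hmul : ∀ i, x i * u.1 i = μ * u.1 i := fun i ↦ by
    have h : (Matrix.diagonal x).mulVec u.1 i = μ * u.1 i :=
      congrFun (congrArg Subtype.val hu.apply_eq_smul) i
    rwa [Matrix.mulVec_diagonal] at h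
  have hu0 : u.1 ≠ 0 := fun h ↦ hu.2 (Subtype.ext h)
  obtain ⟨r, hr⟩ := Function.ne_iff.mp hu0
  rw [Pi.zero_apply] at hr
  have hμr : x r = μ := mul_right_cancel₀ hr (hmul r)
  have hsingle : (Pi.single r 1 : Fin n → ℂ) = (u.1 r)⁻¹ • u.1 := by
    ext i
    by_cases hi : i = r
    · subst hi
      simp [hr]
    · have hui : u.1 i = 0 := by
        by_contra h
        exact hi (hinj ((mul_right_cancel₀ h (hmul i)).trans hμr.symm))
      simp [hi, hui]
  exact ⟨r, hsingle ▸ U.smul_mem _ u.2⟩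

/-- Invariance of the span of two vectors can be checked on these vectors. -/
lemma invariantUnder_span_pair {n : ℕ} {M : Matrix (Fin n) (Fin n) ℂ} {v w : Fin n → ℂ}
    (hv : M.mulVec v ∈ Submodule.span ℂ {v, w}) (hw : M.mulVec w ∈ Submodule.span ℂ {v, w}) :
    InvariantUnder M (Submodule.span ℂ {v, w}) := by
  have h : Submodule.span ℂ {v, w} ≤ (Submodule.span ℂ {v, w}).comap M.mulVecLin := by
    rw [Submodule.span_le]
    rintro y (rfl | rfl)
    exacts [hv, hw]
  exact fun u hu ↦ h hu

/-- Let `T = diag(x)` with the `x_r` pairwise distinct and nonzero, and `A` with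
`(A - λ₁I)(A - λ₂I) = 0`, `λ₁λ₂ ≠ 0`, `ATAT = TATA = δ·I`, `δ ≠ 0`.  Then:
(a) a one-dimensional subspace invariant under both `A` and `T` forces
`δ = λ_i² x_r²` for some `i ∈ {1,2}` and some `r`;
(b) each `span{e_r, A e_r}` is invariant under both `A` and `T`;
consequently every nonzero invariant subspace contains a nonzero invariant subspace of
dimension at most `2`, and every irreducible invariant subspace has dimension at most `2`. -/
theorem stmt7 (n : ℕ) (x : Fin n → ℂ) (hinj : Function.Injective x) (hx0 : ∀ r, x r ≠ 0)
    (A T : Matrix (Fin n) (Fin n) ℂ) (hT : T = Matrix.diagonal x)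
    (l1 l2 : ℂ) (hl : l1 * l2 ≠ 0)
    (hmin : (A - l1 • (1 : Matrix (Fin n) (Fin n) ℂ)) * (A - l2 • 1) = 0)
    (δ : ℂ) (hδ : δ ≠ 0)
    (h1 : A * T * A * T = δ • (1 : Matrix (Fin n) (Fin n) ℂ))
    (h2 : T * A * T * A = δ • (1 : Matrix (Fin n) (Fin n) ℂ)) :
    (∀ U : Submodule ℂ (Fin n → ℂ), InvariantUnder A U → InvariantUnder T U →
      Module.finrank ℂ U = 1 → ∃ r, δ = l1 ^ 2 * x r ^ 2 ∨ δ = l2 ^ 2 * x r ^ 2) ∧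
    (∀ r : Fin n,
      InvariantUnder A (Submodule.span ℂ
        {Pi.single r (1 : ℂ), A.mulVec (Pi.single r (1 : ℂ))}) ∧
      InvariantUnder T (Submodule.span ℂ
        {Pi.single r (1 : ℂ), A.mulVec (Pi.single r (1 : ℂ))})) ∧
    (∀ U : Submodule ℂ (Fin n → ℂ), InvariantUnder A U → InvariantUnder T U → U ≠ ⊥ →
      ∃ U' : Submodule ℂ (Fin n → ℂ), U' ≤ U ∧ U' ≠ ⊥ ∧
        InvariantUnder A U' ∧ InvariantUnder T U' ∧ Module.finrank ℂ U' ≤ 2) ∧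
    (∀ U : Submodule ℂ (Fin n → ℂ), InvariantUnder A U → InvariantUnder T U → U ≠ ⊥ →
      (∀ U' ≤ U, InvariantUnder A U' → InvariantUnder T U' → U' = ⊥ ∨ U' = U) →
      Module.finrank ℂ U ≤ 2) := by
  have hAA : ∀ v, A.mulVec (A.mulVec v) = (l1 + l2) • A.mulVec v - (l1 * l2) • v := fun v ↦ by
    have h : A * A = (l1 + l2) • A - (l1 * l2) • 1 := by
      rw [← sub_eq_zero, ← hmin]
      simp only [sub_mul, mul_sub, smul_mul_assoc, mul_smul_comm, one_mul, mul_one]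
      module
    rw [Matrix.mulVec_mulVec, h, Matrix.sub_mulVec, Matrix.smul_mulVec, Matrix.smul_mulVec,
      Matrix.one_mulVec]
  have hATAT : ∀ v, A.mulVec (T.mulVec (A.mulVec (T.mulVec v))) = δ • v := fun v ↦ by
    rw [Matrix.mulVec_mulVec, Matrix.mulVec_mulVec, Matrix.mulVec_mulVec, h1, Matrix.smul_mulVec, Matrix.one_mulVec]
  have hTe : ∀ r, T.mulVec (Pi.single r 1) = x r • Pi.single r (1 : ℂ) := fun r ↦ by
    ext i
    by_cases hi : i = r
    · subst hi
      simp [hT]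
    · simp [hT, hi]
  have hspan : ∀ r : Fin n,
      InvariantUnder A (Submodule.span ℂ
        {Pi.single r (1 : ℂ), A.mulVec (Pi.single r (1 : ℂ))}) ∧
      InvariantUnder T (Submodule.span ℂ
        {Pi.single r (1 : ℂ), A.mulVec (Pi.single r (1 : ℂ))}) := fun r ↦ by
    have hATA := hATAT (Pi.single r 1)
    have hr := hTe r
    generalize (Pi.single r 1 : Fin n → ℂ) = e at hATA hr ⊢
    have he : e ∈ Submodule.span ℂ {e, A.mulVec e} := Submodule.subset_span (by simp)
    have hAe : A.mulVec e ∈ Submodule.span ℂ {e, A.mulVec e} := Submodule.subset_span (by simp)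
    refine ⟨invariantUnder_span_pair hAe ?_, invariantUnder_span_pair ?_ ?_⟩
    · rw [hAA]
      exact sub_mem (Submodule.smul_mem _ _ hAe) (Submodule.smul_mem _ _ he)
    · rw [hr]
      exact Submodule.smul_mem _ _ he
    · rw [hr, Matrix.mulVec_smul, Matrix.mulVec_smul, Matrix.mulVec_smul] at hATA
      have hsq := hAA (T.mulVec (A.mulVec e))
      have hinv : A.mulVec (T.mulVec (A.mulVec e)) = ((x r)⁻¹ * δ) • e := by
        rw [mul_smul, ← hATA, inv_smul_smul₀ (hx0 r)]
      rw [hinv, Matrix.mulVec_smul, eq_sub_iff_add_eq, ← eq_sub_iff_add_eq'] at hsq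
      rw [← Submodule.smul_mem_iff _ hl, hsq]
      exact sub_mem (Submodule.smul_mem _ _ (Submodule.smul_mem _ _ he))
        (Submodule.smul_mem _ _ hAe)
  have hsub : ∀ U : Submodule ℂ (Fin n → ℂ), InvariantUnder A U → InvariantUnder T U → U ≠ ⊥ →
      ∃ U' : Submodule ℂ (Fin n → ℂ), U' ≤ U ∧ U' ≠ ⊥ ∧
        InvariantUnder A U' ∧ InvariantUnder T U' ∧ Module.finrank ℂ U' ≤ 2 := by
    intro U hA hTU hne
    obtain ⟨r, hr⟩ := exists_single_mem_of_invariantUnder_diagonal hinj (hT ▸ hTU) hne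
    refine ⟨_, ?_, ?_, (hspan r).1, (hspan r).2, ?_⟩
    · rw [Submodule.span_le]
      rintro y (rfl | rfl)
      exacts [hr, hA _ hr]
    · exact Submodule.ne_bot_iff _ |>.mpr
        ⟨Pi.single r 1, Submodule.subset_span (by simp), by simp⟩
    · classical
      have h := finrank_span_finset_le_card (R := ℂ)
        ({Pi.single r 1, A.mulVec (Pi.single r 1)} : Finset (Fin n → ℂ))
      rw [Finset.coe_pair] at h
      exact h.trans Finset.card_le_two
  refine ⟨fun U hA hTU hU ↦ ?_, hspan, hsub, fun U hA hTU hne hirr ↦ ?_⟩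
  · have hne : U ≠ ⊥ := by
      rintro rfl
      simp at hU
    obtain ⟨r, hr⟩ := exists_single_mem_of_invariantUnder_diagonal hinj (hT ▸ hTU) hne
    have he0 : (Pi.single r 1 : Fin n → ℂ) ≠ 0 := by simp
    have hATA := hATAT (Pi.single r 1)
    have hsq := hAA (Pi.single r 1)
    have hTr := hTe r
    have hAr := hA _ hr
    generalize (Pi.single r 1 : Fin n → ℂ) = e at hr he0 hATA hsq hTr hAr
    obtain ⟨c, hc⟩ := (finrank_eq_one_iff_of_nonzero' (⟨e, hr⟩ : U)
      (fun h ↦ he0 (congrArg Subtype.val h))).mp hU ⟨_, hAr⟩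
    replace hc : A.mulVec e = c • e := (congrArg Subtype.val hc).symm
    simp only [hTr, hc, Matrix.mulVec_smul, smul_smul] at hATA hsq
    have hδc := smul_left_injective ℂ he0 hATA
    rw [← sub_smul] at hsq
    have hcc := smul_left_injective ℂ he0 hsq
    have hroot : (c - l1) * (c - l2) = 0 := by linear_combination hcc
    refine ⟨r, (mul_eq_zero.mp hroot).imp (fun h ↦ ?_) (fun h ↦ ?_)⟩
    all_goals
      rw [← sub_eq_zero.mp h]
      linear_combination -hδc
  · obtain ⟨U', hle, hne', hA', hT', hfin⟩ := hsub U hA hTU hne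
    obtain rfl := (hirr U' hle hA' hT').resolve_left hne'
    exact hfin
end

section
/- Let W = ℂⁿ, let T = diag(x_1, …, x_n) with the x_r pairwise distinct and nonzero, and let A be an n×n complex matrix satisfying (A − λ_1 I)(A − λ_2 I)(A − λ_3 I) = 0 with λ_1, λ_2, λ_3 nonzero and pairwise distinct, such that the eigenprojection P := (A − λ_1 I)(A − λ_2 I)/((λ_3 − λ_1)(λ_3 − λ_2)) has rank 1. Assume ATAT = TATA = δ·I with δ ≠ 0, that δ ∉ {λ_k² x_r² : k ∈ {1,2}, 1 ≤ r ≤ n}, and that δ + λ_1λ_2 x_r x_s ≠ 0 for all 1 ≤ r, s ≤ n. Then every diagonal entry P_{rr} of P is nonzero and is given by P_{rr} = [λ_3/((λ_3 − λ_1)(λ_3 − λ_2))] · ∏_{s ≠ r} [(δ + λ_1λ_2 x_r x_s)/(δ(x_r − x_s))] · [ (−1)^{n−1} λ_3 ((λ_1λ_2 x_r + δ x_r^{−1})/δ) (∏_{t=1}^n x_t) − (λ_1 + λ_2)(−δ/(λ_1λ_2))^{(n−1−ε)/2} x_r^{ε} ], where ε = 0 if n is odd and ε = 1 if n is even. Moreover,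 the only subspaces of W invariant under both A and T are 0 and W. -/
open Polynomial in
/-- Solution of the Cauchy-type system with matrix `1 / (1 + q * x r * x s)`, obtained by comparing
two polynomials at `0`, at the square roots of `-1 / q` and at the points `-1 / (q * x r)`. -/
theorem cauchy_system_solution {n : ℕ} {x p : Fin n → ℂ} (hinj : Function.Injective x)
    (hx0 : ∀ r, x r ≠ 0) {q K σ l : ℂ} (hq : q ≠ 0)
    (hxx : ∀ r s, 1 + q * x r * x s ≠ 0)
    (hsys : ∀ r, ∑ s, p s / (1 + q * x r * x s) = K * (l - σ / (1 + q * x r * x r)))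
    {m ε : ℕ} (hε : ε ≤ 1) (hn : n = 2 * m + 1 + ε) (r : Fin n) :
    p r = K * (∏ s ∈ Finset.univ.erase r, (1 + q * x r * x s) / (x r - x s)) *
      ((-1 : ℂ) ^ (n - 1) * l * (q * x r + (x r)⁻¹) * (∏ t, x t) -
        σ * (-1 / q) ^ m * x r ^ ε) := by
  obtain ⟨z, hz⟩ := IsAlgClosed.exists_pow_nat_eq (-1 / q) (n := 2) (by norm_num)
  have hqz : q * z ^ 2 = -1 := by rw [hz]; field_simp
  have hz0 : z ≠ 0 := by rintro rfl; simp at hqz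
  set a : ℂ := -(K * l) * ∏ t, (-x t) with ha
  set β : ℂ := -(K * σ) * (-1 / q) ^ m with hβ
  set y : Fin n → ℂ := fun r => -1 / (q * x r) with hy
  let F : ℂ[X] := (∑ s, C (p s) * X * ∏ t ∈ Finset.univ.erase s, (X - C (x t))) * (1 + C q * X ^ 2)
    - C K * (C l * (1 + C q * X ^ 2) - C (σ * q) * X ^ 2) * ∏ t, (X - C (x t))
    - (∏ t, (1 + C (q * x t) * X)) * (C a * (1 + C q * X ^ 2) + C β * X ^ (1 + ε))
  have hFeval : ∀ w, F.eval w =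
      (∑ s, p s * w * ∏ t ∈ Finset.univ.erase s, (w - x t)) * (1 + q * w ^ 2)
      - K * (l * (1 + q * w ^ 2) - σ * q * w ^ 2) * ∏ t, (w - x t)
      - (∏ t, (1 + q * x t * w)) * (a * (1 + q * w ^ 2) + β * w ^ (1 + ε)) := by
    intro w
    simp [F, eval_finsetSum, eval_prod]
  have hroot0 : F.eval 0 = 0 := by
    rw [hFeval, ha]; simp
  have hrootz : ∀ w, q * w ^ 2 = -1 → F.eval w = 0 := by
    intro w hw
    have hw0 : w ≠ 0 := by rintro rfl; simp at hw
    have h1 : ∏ t, (1 + q * x t * w) = (∏ t, (w - x t)) * (-q * w) ^ n := by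
      have : ∀ t, 1 + q * x t * w = (w - x t) * (-q * w) := by
        intro t; linear_combination hw
      rw [Finset.prod_congr rfl fun t _ => this t, Finset.prod_mul_distrib]
      simp
    have h2 : (-q * w) ^ n * (β * w ^ (1 + ε)) = -(K * σ) := by
      have h3 : -1 / q = w ^ 2 := by field_simp; linear_combination -hw
      have h4 : (-q * w) ^ n * w ^ n = 1 := by
        rw [← mul_pow, show -q * w * w = 1 by linear_combination -hw, one_pow]
      rw [hβ, h3]
      have h5 : w ^ n = (w ^ 2) ^ m * w ^ (1 + ε) := by
        rw [← pow_mul, ← pow_add, hn]; congr 1; ring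
      rw [h5] at h4
      linear_combination -(K * σ) * h4
    rw [hFeval, h1]
    have h6 : 1 + q * w ^ 2 = 0 := by rw [hw]; ring
    rw [h6]
    linear_combination (-(∏ t, (w - x t))) * h2 + K * σ * (∏ t, (w - x t)) * hw
  have hqx : ∀ r, q * x r ≠ 0 := fun r => mul_ne_zero hq (hx0 r)
  have hrooty : ∀ r, F.eval (y r) = 0 := by
    intro r
    have hne : ∀ s, y r - x s ≠ 0 := by
      intro s h
      apply hxx r s
      have : y r = x s := sub_eq_zero.mp h
      rw [← this, hy]; field_simp [hqx r, hx0 r]; ring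
    have h1 : ∑ s, p s * y r * ∏ t ∈ Finset.univ.erase s, (y r - x t)
        = (∏ t, (y r - x t)) * ∑ s, p s / (1 + q * x r * x s) := by
      rw [Finset.mul_sum]
      refine Finset.sum_congr rfl fun s _ => ?_
      rw [← Finset.mul_prod_erase Finset.univ (fun t => y r - x t) (Finset.mem_univ s)]
      have h2 : y r * (1 + q * x r * x s) = y r - x s := by
        rw [hy]; field_simp [hx0 r]; ring
      have := hxx r s
      rw [← h2]
      field_simp
    have h3 : ∏ t, (1 + q * x t * y r) = 0 := by
      refine Finset.prod_eq_zero (Finset.mem_univ r) ?_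
      rw [hy]; field_simp [hx0 r]; ring
    have h4 : q * (y r) ^ 2 * (q * x r * x r) = 1 := by
      rw [hy]; field_simp [hx0 r]
    have h5 : (1 + q * (y r) ^ 2) * (q * x r * x r) = 1 + q * x r * x r := by
      linear_combination h4
    have h6 : q * x r * x r ≠ 0 := mul_ne_zero (hqx r) (hx0 r)
    have h7 := hxx r r
    rw [hFeval, h1, h3, hsys]
    have h8 : q * (y r) ^ 2 = 1 / (q * x r * x r) := by
      rw [eq_div_iff h6, h4]
    have h9 : σ * q * (y r) ^ 2 = σ * (1 / (q * x r * x r)) := by rw [← h8]; ring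
    rw [h9, h8]
    generalize q * x r * x r = e at *
    field_simp
    ring
  have hdeg : F.natDegree ≤ n + 2 := by
    have hquad : (1 + C q * X ^ 2 : ℂ[X]).natDegree ≤ 2 := by compute_degree
    have hquad' : (C l * (1 + C q * X ^ 2) - C (σ * q) * X ^ 2 : ℂ[X]).natDegree ≤ 2 := by
      compute_degree
    have hquad'' : (C a * (1 + C q * X ^ 2) + C β * X ^ (1 + ε) : ℂ[X]).natDegree ≤ 2 := by
      refine natDegree_add_le_of_degree_le (by compute_degree) ?_
      exact (natDegree_C_mul_X_pow_le _ _).trans (by omega)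
    have hprod : ∀ (S : Finset (Fin n)) (f : Fin n → ℂ[X]), (∀ t, (f t).natDegree ≤ 1) →
        (∏ t ∈ S, f t).natDegree ≤ S.card := by
      intro S f hf
      refine (natDegree_prod_le _ _).trans ?_
      simpa using Finset.sum_le_sum fun t (_ : t ∈ S) => hf t
    have hlin : ∀ t, (X - C (x t) : ℂ[X]).natDegree ≤ 1 := fun t => by compute_degree
    have hlin' : ∀ t, (1 + C (q * x t) * X : ℂ[X]).natDegree ≤ 1 := fun t => by compute_degree
    have hfull := hprod Finset.univ _ hlin
    have hfull' := hprod Finset.univ _ hlin'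
    rw [Finset.card_univ, Fintype.card_fin] at hfull hfull'
    refine (natDegree_sub_le_of_le (m := n + 2) (n := n + 2)
      ((natDegree_sub_le_of_le (m := n + 2) (n := n + 2) ?_ ?_).trans (max_self _).le) ?_).trans
      (max_self _).le
    · refine natDegree_mul_le_of_le ?_ hquad
      refine natDegree_sum_le_of_forall_le _ _ fun s _ => ?_
      have h1 := hprod (Finset.univ.erase s) _ hlin
      rw [Finset.card_erase_of_mem (Finset.mem_univ s), Finset.card_univ, Fintype.card_fin] at h1
      refine (natDegree_mul_le_of_le (m := 1) (by compute_degree) h1).trans ?_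
      omega
    · rw [mul_assoc]
      refine (natDegree_C_mul_le _ _).trans ?_
      refine (natDegree_mul_le_of_le hquad' hfull).trans (by omega)
    · exact natDegree_mul_le_of_le hfull' hquad''
  have hyinj : Function.Injective y := by
    intro i j hij
    apply hinj
    have h1 := hx0 i
    have h2 := hx0 j
    simp only [hy] at hij
    field_simp at hij
    linear_combination hij
  have hy0 : ∀ r, y r ≠ 0 := fun r => div_ne_zero (by norm_num) (hqx r)
  have hyz : ∀ r, q * (y r) ^ 2 ≠ -1 := by
    intro r h
    apply hxx r r
    have h4 : q * (y r) ^ 2 * (q * x r * x r) = 1 := by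
      have := hx0 r
      rw [hy]; field_simp
    linear_combination h * (q * x r * x r) - h4
  have hF : F = 0 := by
    refine eq_zero_of_natDegree_lt_card_of_eval_eq_zero' F
      (insert 0 (insert z (insert (-z) (Finset.univ.image y)))) ?_ ?_
    · intro w hw
      simp only [Finset.mem_insert, Finset.mem_image, Finset.mem_univ, true_and] at hw
      rcases hw with rfl | rfl | rfl | ⟨r, rfl⟩
      · exact hroot0
      · exact hrootz _ hqz
      · exact hrootz _ (by rw [neg_sq, hqz])
      · exact hrooty r
    · rw [Finset.card_insert_of_notMem, Finset.card_insert_of_notMem,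
        Finset.card_insert_of_notMem, Finset.card_image_of_injective _ hyinj, Finset.card_univ,
        Fintype.card_fin]
      · omega
      · simp only [Finset.mem_image, Finset.mem_univ, true_and, not_exists]
        intro r h
        exact hyz r (by rw [h, neg_sq, hqz])
      · simp only [Finset.mem_insert, Finset.mem_image, Finset.mem_univ, true_and, not_or,
          not_exists]
        refine ⟨fun h => hz0 (self_eq_neg.mp h), fun r h => hyz r (by rw [h, hqz])⟩
      · simp only [Finset.mem_insert, Finset.mem_image, Finset.mem_univ, true_and, not_or,
          not_exists]
        exact ⟨hz0.symm, (neg_ne_zero.mpr hz0).symm, fun r => hy0 r⟩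
  have hev : F.eval (x r) = 0 := by rw [hF, eval_zero]
  rw [hFeval] at hev
  have h1 : ∏ t, (x r - x t) = 0 := Finset.prod_eq_zero (Finset.mem_univ r) (sub_self _)
  have h2 : ∑ s, p s * x r * ∏ t ∈ Finset.univ.erase s, (x r - x t)
      = p r * x r * ∏ t ∈ Finset.univ.erase r, (x r - x t) := by
    refine Finset.sum_eq_single r (fun s _ hs => ?_) (by simp)
    rw [Finset.prod_eq_zero (i := r) (by simp [hs.symm]) (sub_self _), mul_zero]
  have h3 : ∏ t, (1 + q * x t * x r)
      = (1 + q * x r * x r) * ∏ t ∈ Finset.univ.erase r, (1 + q * x r * x t) := by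
    rw [← Finset.mul_prod_erase _ _ (Finset.mem_univ r)]
    congr 1
    exact Finset.prod_congr rfl fun t _ => by ring
  have h4 : ∏ t, (-x t) = -((-1) ^ (n - 1) * ∏ t, x t) := by
    have : ∏ t, (-x t) = (-1) ^ n * ∏ t, x t := by
      simp [Finset.prod_neg]
    rw [this]
    obtain ⟨k, rfl⟩ : ∃ k, n = k + 1 := ⟨n - 1, by omega⟩
    rw [Nat.add_sub_cancel, pow_succ]; ring
  have h5 : ∏ t ∈ Finset.univ.erase r, (x r - x t) ≠ 0 := by
    refine Finset.prod_ne_zero_iff.mpr fun t ht => ?_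
    exact sub_ne_zero.mpr fun h => (Finset.ne_of_mem_erase ht) (hinj h).symm
  rw [h1, h2, h3, ha, hβ, h4] at hev
  rw [Finset.prod_div_distrib]
  have h6 := hxx r r
  have h7 := hx0 r
  have h8 : p r * x r * ∏ t ∈ Finset.univ.erase r, (x r - x t) =
      (∏ t ∈ Finset.univ.erase r, (1 + q * x r * x t)) *
       (-(K * l) * -((-1) ^ (n - 1) * ∏ t, x t) * (1 + q * x r ^ 2) +
        -(K * σ) * (-1 / q) ^ m * x r ^ (1 + ε)) := by
    apply mul_right_cancel₀ h6
    linear_combination hev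
  generalize (-1 / q) ^ m = d at *
  generalize ∏ t ∈ Finset.univ.erase r, (1 + q * x r * x t) = N at *
  generalize ∏ t ∈ Finset.univ.erase r, (x r - x t) = D at *
  rw [pow_add, pow_one] at h8
  field_simp
  linear_combination h8

/-- A matrix of rank one is an outer product. -/
theorem Matrix.exists_eq_mul_of_rank_eq_one {n : ℕ} {P : Matrix (Fin n) (Fin n) ℂ}
    (h : P.rank = 1) : ∃ u v : Fin n → ℂ, ∀ r s, P r s = u r * v s := by
  rw [Matrix.rank, finrank_eq_one_iff'] at h
  obtain ⟨⟨u, _⟩, _, h⟩ := h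
  choose c hc using fun s => h ⟨P.mulVecLin (Pi.single s 1), LinearMap.mem_range_self _ _⟩
  refine ⟨u, c, fun r s => ?_⟩
  have := congrFun (congrArg Subtype.val (hc s)) r
  simp at this
  rw [mul_comm, this]

/-- A subspace invariant under a diagonal matrix with distinct entries contains every standard basis
vector on which one of its elements is supported. -/
theorem Submodule.single_mem_of_diagonal_invariant {n : ℕ} {x : Fin n → ℂ}
    (hinj : Function.Injective x) {U : Submodule ℂ (Fin n → ℂ)}
    (hU : ∀ u ∈ U, (Matrix.diagonal x).mulVec u ∈ U) {w : Fin n → ℂ} (hw : w ∈ U) {s : Fin n}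
    (hs : w s ≠ 0) : Pi.single s (1 : ℂ) ∈ U := by
  have key : ∀ S : Finset (Fin n), (fun t => (∏ r ∈ S, (x t - x r)) * w t) ∈ U := by
    intro S
    induction S using Finset.induction_on with
    | empty => simpa using hw
    | insert a S ha ih =>
      have := U.sub_mem (hU _ ih) (U.smul_mem (x a) ih)
      convert this using 1
      ext t
      rw [Finset.prod_insert ha]
      simp [Matrix.mulVec_diagonal]
      ring
  have h0 : (∏ r ∈ Finset.univ.erase s, (x s - x r)) * w s ≠ 0 := by
    refine mul_ne_zero (Finset.prod_ne_zero_iff.mpr fun t ht => ?_) hs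
    exact sub_ne_zero.mpr fun h => (Finset.ne_of_mem_erase ht) (hinj h).symm
  convert U.smul_mem ((∏ r ∈ Finset.univ.erase s, (x s - x r)) * w s)⁻¹
    (key (Finset.univ.erase s)) using 1
  ext t
  by_cases hts : t = s
  · subst hts
    simp only [Pi.single_eq_same, Pi.smul_apply, smul_eq_mul]
    rw [inv_mul_cancel₀ h0]
  · have : ∏ r ∈ Finset.univ.erase s, (x t - x r) = 0 :=
      Finset.prod_eq_zero (i := t) (by simp [hts]) (sub_self _)
    simp [Pi.single_eq_of_ne hts, this]

/-- Theorem 3.3 of [MW3] / Prop. 5.7 of [Wexc]: with `T = diag(x)` (`x_r` pairwise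
distinct and nonzero), `A` satisfying a cubic with nonzero pairwise distinct eigenvalues
`λ₁, λ₂, λ₃` whose eigenprojection `P` for `λ₃` has rank `1`, `ATAT = TATA = δ·I`,
`δ ≠ 0`, `δ ∉ {λ_k² x_r²}` (`k = 1,2`) and `δ + λ₁λ₂ x_r x_s ≠ 0` for all `r, s`:
every diagonal entry `P_{rr}` is nonzero and given by the explicit product formula,
and the only invariant subspaces under both `A` and `T` are `0` and everything. -/
theorem stmt8 (n : ℕ) (x : Fin n → ℂ) (hinj : Function.Injective x) (hx0 : ∀ r, x r ≠ 0)
    (A T : Matrix (Fin n) (Fin n) ℂ) (hT : T = Matrix.diagonal x)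
    (l1 l2 l3 : ℂ) (hl1 : l1 ≠ 0) (hl2 : l2 ≠ 0) (hl3 : l3 ≠ 0)
    (h12 : l1 ≠ l2) (h13 : l1 ≠ l3) (h23 : l2 ≠ l3)
    (hmin : (A - l1 • (1 : Matrix (Fin n) (Fin n) ℂ)) * (A - l2 • 1) * (A - l3 • 1) = 0)
    (P : Matrix (Fin n) (Fin n) ℂ)
    (hP : P = ((l3 - l1) * (l3 - l2))⁻¹ • ((A - l1 • 1) * (A - l2 • 1)))
    (hrank : P.rank = 1)
    (δ : ℂ) (hδ : δ ≠ 0)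
    (hATAT : A * T * A * T = δ • (1 : Matrix (Fin n) (Fin n) ℂ))
    (hTATA : T * A * T * A = δ • (1 : Matrix (Fin n) (Fin n) ℂ))
    (hδ1 : ∀ r, δ ≠ l1 ^ 2 * x r ^ 2) (hδ2 : ∀ r, δ ≠ l2 ^ 2 * x r ^ 2)
    (hδ3 : ∀ r s, δ + l1 * l2 * x r * x s ≠ 0)
    (ε : ℕ) (hε : ε = if n % 2 = 0 then 1 else 0) :
    (∀ r, P r r ≠ 0 ∧
      P r r = l3 / ((l3 - l1) * (l3 - l2)) *
        (∏ s ∈ Finset.univ.erase r, (δ + l1 * l2 * x r * x s) / (δ * (x r - x s))) *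
        ((-1 : ℂ) ^ (n - 1) * l3 * ((l1 * l2 * x r + δ * (x r)⁻¹) / δ) * (∏ t, x t) -
          (l1 + l2) * (-δ / (l1 * l2)) ^ ((n - 1 - ε) / 2) * x r ^ ε)) ∧
    (∀ U : Submodule ℂ (Fin n → ℂ),
      (∀ u ∈ U, A.mulVec u ∈ U) → (∀ u ∈ U, T.mulVec u ∈ U) → U = ⊥ ∨ U = ⊤) := by
  have hc : (l3 - l1) * (l3 - l2) ≠ 0 :=
    mul_ne_zero (sub_ne_zero.mpr h13.symm) (sub_ne_zero.mpr h23.symm)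
  generalize hcdef : (l3 - l1) * (l3 - l2) = c at *
  have hcP : c • P = (A - l1 • 1) * (A - l2 • 1) := by
    rw [hP, smul_smul, mul_inv_cancel₀ hc, one_smul]
  have hquad : A * A - (l1 + l2) • A + (l1 * l2) • (1 : Matrix (Fin n) (Fin n) ℂ) = c • P := by
    rw [hcP]
    simp only [Matrix.sub_mul, Matrix.mul_sub, Matrix.smul_mul, Matrix.mul_smul, Matrix.one_mul,
      Matrix.mul_one]
    module
  have hPA : P * A = l3 • P := by
    have h : c • (P * A - l3 • P) = 0 := by
      rw [← hmin, ← hcP]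
      simp only [Matrix.mul_sub, Matrix.smul_mul, Matrix.mul_smul, Matrix.mul_one]
      module
    exact sub_eq_zero.mp ((smul_eq_zero.mp h).resolve_left hc)
  have hAP : A * P = l3 • P := by
    have h : c • (A * P) = c • (P * A) := by
      rw [← Matrix.mul_smul, ← Matrix.smul_mul, ← hquad]
      simp only [Matrix.add_mul, Matrix.mul_add, Matrix.sub_mul, Matrix.mul_sub, Matrix.smul_mul,
        Matrix.mul_smul, Matrix.one_mul, Matrix.mul_one, Matrix.mul_assoc]
    rw [← hPA]
    exact smul_right_injective _ hc h
  have hAB : A * (T * A * T) = δ • (1 : Matrix (Fin n) (Fin n) ℂ) := by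
    rw [← hATAT]; simp only [Matrix.mul_assoc]
  have hlin : l3 • (δ • A - ((l1 + l2) * δ) • (1 : Matrix (Fin n) (Fin n) ℂ)
      + (l1 * l2) • (T * A * T)) = (c * δ) • P := by
    have h1 : l3 • (P * (T * A * T)) = δ • P := by
      rw [← Matrix.smul_mul, ← hPA, Matrix.mul_assoc, hAB, Matrix.mul_smul, Matrix.mul_one]
    have h2 := congrArg (· * (T * A * T)) hquad
    simp only [Matrix.add_mul, Matrix.sub_mul, Matrix.smul_mul, Matrix.one_mul] at h2
    rw [Matrix.mul_assoc, hAB, Matrix.mul_smul, Matrix.mul_one] at h2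
    rw [mul_smul c δ P, ← h1, smul_comm c l3, ← h2]
    module
  have hentry : ∀ r s, l3 * (δ + l1 * l2 * x r * x s) * A r s =
      l3 * (l1 + l2) * δ * (1 : Matrix (Fin n) (Fin n) ℂ) r s + c * δ * P r s := by
    intro r s
    have h := congrFun (congrFun hlin r) s
    simp only [hT, Matrix.smul_apply, Matrix.add_apply, Matrix.sub_apply, smul_eq_mul,
      Matrix.mul_diagonal, Matrix.diagonal_mul] at h
    linear_combination h
  obtain ⟨u, v, huv⟩ := Matrix.exists_eq_mul_of_rank_eq_one hrank
  have hne : ∀ r, P r r ≠ 0 := by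
    intro r hr
    have hoff : ∀ s, s ≠ r → A r s * A s r = 0 := by
      intro s hs
      have h1 := hentry r s
      have h2 := hentry s r
      rw [Matrix.one_apply_ne hs.symm] at h1
      rw [Matrix.one_apply_ne hs] at h2
      have h3 : P r s * P s r = 0 := by
        rw [huv] at hr ⊢
        rw [huv]
        linear_combination u s * v s * hr
      have h4 : l3 * (δ + l1 * l2 * x r * x s) * (l3 * (δ + l1 * l2 * x s * x r)) ≠ 0 :=
        mul_ne_zero (mul_ne_zero hl3 (hδ3 r s)) (mul_ne_zero hl3 (hδ3 s r))
      apply (mul_eq_zero.mp _).resolve_left h4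
      linear_combination (l3 * (δ + l1 * l2 * x s * x r) * A s r) * h1
        + c * δ * P r s * h2 + (c * δ) ^ 2 * h3
    have hAA : (A * A) r r = A r r * A r r := by
      rw [Matrix.mul_apply]
      exact Finset.sum_eq_single r (fun s _ hs => hoff s hs) (by simp)
    have hATA : (A * T * A * T) r r = A r r ^ 2 * x r ^ 2 := by
      rw [hT, Matrix.mul_diagonal, Matrix.mul_apply,
        Finset.sum_eq_single r (fun s _ hs => ?_) (by simp), Matrix.mul_diagonal]
      · ring
      · rw [Matrix.mul_diagonal]
        linear_combination x s * hoff s hs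
    rw [hATAT, Matrix.smul_apply, Matrix.one_apply_eq, smul_eq_mul, mul_one] at hATA
    have h := congrFun (congrFun hquad r) r
    simp only [Matrix.add_apply, Matrix.sub_apply, Matrix.smul_apply, smul_eq_mul, hAA, hr,
      Matrix.one_apply_eq] at h
    have h' : (A r r - l1) * (A r r - l2) = 0 := by linear_combination h
    rcases mul_eq_zero.mp h' with h' | h'
    · exact hδ1 r (by rw [← sub_eq_zero.mp h']; exact hATA)
    · exact hδ2 r (by rw [← sub_eq_zero.mp h']; exact hATA)
  refine ⟨fun r => ⟨hne r, ?_⟩, ?_⟩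
  · have hq : l1 * l2 / δ ≠ 0 := div_ne_zero (mul_ne_zero hl1 hl2) hδ
    have hscale : ∀ r s, 1 + l1 * l2 / δ * x r * x s = (δ + l1 * l2 * x r * x s) / δ := by
      intro r s; field_simp
    have hsys : ∀ r, ∑ s, P s s / (1 + l1 * l2 / δ * x r * x s)
        = l3 / c * (l3 - (l1 + l2) / (1 + l1 * l2 / δ * x r * x r)) := by
      intro r
      have hA : ∀ s, A r s * P s r = P r r * ((c / l3) * (P s s / (1 + l1 * l2 / δ * x r * x s))
          + (l1 + l2) / (1 + l1 * l2 / δ * x r * x r) * (1 : Matrix (Fin n) (Fin n) ℂ) r s) := by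
        intro s
        have h1 := hentry r s
        have h2 := hδ3 r s
        have h3 : P r s * P s r = P r r * P s s := by simp only [huv]; ring
        rw [hscale, hscale]
        by_cases hrs : r = s
        · subst hrs
          rw [Matrix.one_apply_eq] at h1 ⊢
          generalize δ + l1 * l2 * x r * x r = d at *
          field_simp
          linear_combination P r r * h1
        · rw [Matrix.one_apply_ne hrs] at h1 ⊢
          field_simp
          linear_combination P s r * h1 + c * δ * h3
      have h := congrFun (congrFun hAP r) r
      rw [Matrix.mul_apply, Finset.sum_congr rfl fun s _ => hA s, ← Finset.mul_sum,
        Finset.sum_add_distrib, ← Finset.mul_sum, ← Finset.mul_sum] at h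
      have h1 : ∑ s, (1 : Matrix (Fin n) (Fin n) ℂ) r s = 1 := by simp [Matrix.one_apply]
      rw [h1, Matrix.smul_apply, smul_eq_mul, mul_comm l3] at h
      have h2 := mul_left_cancel₀ (hne r) h
      generalize ∑ s, P s s / (1 + l1 * l2 / δ * x r * x s) = S at *
      generalize (l1 + l2) / (1 + l1 * l2 / δ * x r * x r) = τ at *
      field_simp at h2 ⊢
      linear_combination h2
    have hn : n = 2 * ((n - 1 - ε) / 2) + 1 + ε := by
      have := r.pos
      split_ifs at hε <;> omega
    have hε1 : ε ≤ 1 := by split_ifs at hε <;> omega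
    have h := cauchy_system_solution hinj hx0 hq
      (fun r s => by rw [hscale]; exact div_ne_zero (hδ3 r s) hδ) hsys hε1 hn r
    rw [h]
    have h1 : -1 / (l1 * l2 / δ) = -δ / (l1 * l2) := by field_simp
    have h2 : l1 * l2 / δ * x r + (x r)⁻¹ = (l1 * l2 * x r + δ * (x r)⁻¹) / δ := by field_simp
    have h3 : ∏ s ∈ Finset.univ.erase r, (1 + l1 * l2 / δ * x r * x s) / (x r - x s)
        = ∏ s ∈ Finset.univ.erase r, (δ + l1 * l2 * x r * x s) / (δ * (x r - x s)) :=
      Finset.prod_congr rfl fun s _ => by rw [hscale, div_div]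
    rw [h1, h2, h3]
  · intro U hUA hUT
    rw [or_iff_not_imp_left]
    intro hU
    obtain ⟨w, hw, hw0⟩ := U.ne_bot_iff.mp hU
    obtain ⟨s, hs⟩ := Function.ne_iff.mp hw0
    rw [hT] at hUT
    have hs' := Submodule.single_mem_of_diagonal_invariant hinj hUT hw hs
    have hPs : P.mulVec (Pi.single s 1) ∈ U := by
      have hsub : ∀ l : ℂ, ∀ w ∈ U, (A - l • 1).mulVec w ∈ U := by
        intro l w hw
        rw [Matrix.sub_mulVec, Matrix.smul_mulVec, Matrix.one_mulVec]
        exact U.sub_mem (hUA w hw) (U.smul_mem _ hw)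
      rw [hP, Matrix.smul_mulVec, ← Matrix.mulVec_mulVec]
      exact U.smul_mem _ (hsub _ _ (hsub _ _ hs'))
    have hall : ∀ r, Pi.single r (1 : ℂ) ∈ U := by
      intro r
      refine Submodule.single_mem_of_diagonal_invariant hinj hUT hPs ?_
      have h1 := hne r
      have h2 := hne s
      rw [huv] at h1 h2
      simp only [Matrix.mulVec_single_one, Matrix.col_apply, huv]
      exact mul_ne_zero (left_ne_zero_of_mul h1) (right_ne_zero_of_mul h2)
    rw [eq_top_iff]
    intro w _
    rw [pi_eq_sum_univ' w]
    exact U.sum_mem fun i _ => U.smul_mem _ (hall i)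
end

section
/- Let q ∈ ℂ be nonzero and suppose q² is not a primitive ℓ-th root of unity for any ℓ ∈ {2, 3, 4, 5, 6, 9}. Let n ≥ 0 be an integer. If for every dominant G_2 weight μ = (μ1, μ2) with μ1 + μ2 ≤ n the product [μ1−μ2+1][2μ1+μ2+5][μ1+2μ2+4][3μ1+6][3μ2+3][3μ1+3μ2+9] is nonzero (equivalently, d_μ ≠ 0, since the denominator [1][5][4][6][3][9] is nonzero under these hypotheses), then [m] ≠ 0 for all integers m with 1 < m ≤ 2n+5, and [3m] ≠ 0 for all integers m with 1 < m ≤ n+3. -/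
/-- The quantum integer `[m] = q^{m-1} + q^{m-3} + ⋯ + q^{1-m}`. -/
noncomputable def qInt (q : ℂ) (m : ℕ) : ℂ :=
  ∑ i ∈ Finset.range m, q ^ ((m : ℤ) - 1 - 2 * (i : ℤ))

theorem qInt_eq_mul_geom_sum {q : ℂ} (hq : q ≠ 0) (m : ℕ) :
    qInt q m = q ^ ((m : ℤ) - 1) * ∑ i ∈ Finset.range m, ((q ^ 2)⁻¹) ^ i := by
  rw [qInt, Finset.mul_sum]
  refine Finset.sum_congr rfl fun i _ => ?_
  rw [zpow_sub₀ hq, zpow_mul, div_eq_mul_inv, zpow_natCast, inv_pow]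
  norm_cast

theorem qInt_eq_zero_iff {q : ℂ} (hq : q ≠ 0) (m : ℕ) :
    qInt q m = 0 ↔ m = 0 ∨ (orderOf (q ^ 2) ≠ 1 ∧ orderOf (q ^ 2) ∣ m) := by
  rw [qInt_eq_mul_geom_sum hq, mul_eq_zero, or_iff_right (zpow_ne_zero _ hq), Ne,
    orderOf_eq_one_iff, orderOf_dvd_iff_pow_eq_one]
  by_cases h : q ^ 2 = 1
  · simp [h]
  · have hinv : (q ^ 2)⁻¹ ≠ 1 := by rwa [Ne, inv_eq_one]
    rw [geom_sum_eq hinv, div_eq_zero_iff, or_iff_left (sub_ne_zero.2 hinv), sub_eq_zero, inv_pow,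
      inv_eq_one]
    simp only [h, not_false_eq_true, true_and, iff_or_self]
    rintro rfl
    exact pow_zero _

/-- Corollary 1.2: if `q ≠ 0`, `q²` is not a primitive `ℓ`-th root of unity for
`ℓ ∈ {2,3,4,5,6,9}`, and the numerator of the quantum dimension `d_μ` is nonzero for
every dominant `G₂` weight `μ` with `μ₁ + μ₂ ≤ n`, then `[m] ≠ 0` for `1 < m ≤ 2n+5`
and `[3m] ≠ 0` for `1 < m ≤ n+3`. -/
theorem stmt9 (q : ℂ) (hq : q ≠ 0)
    (hprim : ∀ ℓ ∈ ({2, 3, 4, 5, 6, 9} : Finset ℕ), ¬ IsPrimitiveRoot (q ^ 2) ℓ)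
    (n : ℕ)
    (hd : ∀ μ1 μ2 : ℕ, μ2 ≤ μ1 → μ1 + μ2 ≤ n →
      qInt q (μ1 - μ2 + 1) * qInt q (2 * μ1 + μ2 + 5) * qInt q (μ1 + 2 * μ2 + 4) *
        qInt q (3 * μ1 + 6) * qInt q (3 * μ2 + 3) * qInt q (3 * μ1 + 3 * μ2 + 9) ≠ 0) :
    (∀ m : ℕ, 1 < m → m ≤ 2 * n + 5 → qInt q m ≠ 0) ∧
    (∀ m : ℕ, 1 < m → m ≤ n + 3 → qInt q (3 * m) ≠ 0) := by
  have hord : ∀ ℓ ∈ ({2, 3, 4, 5, 6, 9} : Finset ℕ), orderOf (q ^ 2) ≠ ℓ := fun ℓ hℓ h =>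
    hprim ℓ hℓ (h ▸ IsPrimitiveRoot.orderOf (q ^ 2))
  simp only [Finset.mem_insert, Finset.mem_singleton, forall_eq_or_imp, forall_eq] at hord
  simp only [mul_ne_zero_iff, Ne, qInt_eq_zero_iff hq] at hd ⊢
  generalize orderOf (q ^ 2) = ℓ at hd hord ⊢
  have hfirst : ∀ m : ℕ, 1 < m → m ≤ 2 * n + 5 → ¬(m = 0 ∨ ℓ ≠ 1 ∧ ℓ ∣ m) := by
    rintro m hm hmn (rfl | ⟨hℓ, hdvd⟩)
    · omega
    have hle := Nat.le_of_dvd (by omega) hdvd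
    have hpos := Nat.pos_of_dvd_of_pos hdvd (by omega)
    obtain ⟨k, rfl | rfl⟩ := Nat.even_or_odd' ℓ
    · refine (hd (k - 3) 1 (by omega) (by omega)).1.1.1.1.2 (Or.inr ⟨hℓ, ?_⟩)
      exact dvd_of_eq (by omega)
    · refine (hd (k - 2) 0 (by omega) (by omega)).1.1.1.1.2 (Or.inr ⟨hℓ, ?_⟩)
      exact dvd_of_eq (by omega)
  refine ⟨hfirst, ?_⟩
  rintro m hm hmn (h | ⟨hℓ, hdvd⟩)
  · omega
  by_cases h3 : 3 ∣ ℓ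
  · obtain ⟨k, rfl⟩ := h3
    have hk : k ∣ m := Nat.dvd_of_mul_dvd_mul_left (by norm_num) hdvd
    have hle := Nat.le_of_dvd (by omega) hk
    have hpos := Nat.pos_of_dvd_of_pos hk (by omega)
    refine (hd (k - 3) 0 (by omega) (by omega)).2 (Or.inr ⟨hℓ, ?_⟩)
    exact dvd_of_eq (by omega)
  · have hcop : Nat.Coprime ℓ 3 := ((Nat.Prime.coprime_iff_not_dvd Nat.prime_three).2 h3).symm
    exact hfirst m hm (by omega) (Or.inr ⟨hℓ, hcop.dvd_of_dvd_mul_left hdvd⟩)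
end

section
/- Let λ_1, λ_2, λ_3, λ_4, Θ be nonzero complex numbers satisfying the four equations Θ = λ_3²Θ², λ_4²Θ² = 1, λ_1²Θ² = (λ_1λ_2λ_3)²Θ³, and −(λ_1λ_2)³Θ³ = λ_1⁶λ_2³λ_3³Θ⁴. Then λ_2² = 1, λ_3 = −λ_1^{−3}, Θ = λ_1⁶, and λ_4² = λ_1^{−12}. In particular, writing λ_1 = q², one gets λ_3 = −q^{−6}, Θ = q^{12} and λ_4 = ±q^{−12}. -/
/-- Let `λ₁, λ₂, λ₃, λ₄, Θ` be nonzero complex numbers satisfying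
`Θ = λ₃²Θ²`, `λ₄²Θ² = 1`, `λ₁²Θ² = (λ₁λ₂λ₃)²Θ³` and `−(λ₁λ₂)³Θ³ = λ₁⁶λ₂³λ₃³Θ⁴`.
Then `λ₂² = 1`, `λ₃ = −λ₁⁻³`, `Θ = λ₁⁶` and `λ₄² = λ₁⁻¹²`.  In particular, writing
`λ₁ = q²`, one gets `λ₃ = −q⁻⁶`, `Θ = q¹²` and `λ₄ = ±q⁻¹²`. -/
theorem stmt13 (l1 l2 l3 l4 Θ : ℂ)
    (h1 : l1 ≠ 0) (h2 : l2 ≠ 0) (h3 : l3 ≠ 0) (h4 : l4 ≠ 0) (hΘ : Θ ≠ 0)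
    (e1 : Θ = l3 ^ 2 * Θ ^ 2)
    (e2 : l4 ^ 2 * Θ ^ 2 = 1)
    (e3 : l1 ^ 2 * Θ ^ 2 = (l1 * l2 * l3) ^ 2 * Θ ^ 3)
    (e4 : -(l1 * l2) ^ 3 * Θ ^ 3 = l1 ^ 6 * l2 ^ 3 * l3 ^ 3 * Θ ^ 4) :
    l2 ^ 2 = 1 ∧ l3 = -(l1⁻¹ ^ 3) ∧ Θ = l1 ^ 6 ∧ l4 ^ 2 = l1⁻¹ ^ 12 ∧
    ∀ q : ℂ, l1 = q ^ 2 →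
      l3 = -(q⁻¹ ^ 6) ∧ Θ = q ^ 12 ∧ (l4 = q⁻¹ ^ 12 ∨ l4 = -(q⁻¹ ^ 12)) := by
  have hl3Θ : l3 ^ 2 * Θ = 1 :=
    mul_right_cancel₀ hΘ (by linear_combination -e1)
  have hl2 : l2 ^ 2 = 1 := by
    have h : l1 ^ 2 * Θ ^ 2 ≠ 0 := by positivity
    exact mul_left_cancel₀ h (by
      linear_combination -e3 - l1 ^ 2 * l2 ^ 2 * Θ ^ 2 * hl3Θ)
  have hl1l3 : l1 ^ 3 * l3 = -1 := by
    have h : l1 ^ 3 * l2 ^ 3 * Θ ^ 3 ≠ 0 := by positivity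
    exact mul_left_cancel₀ h (by
      linear_combination -e4 - l1 ^ 6 * l2 ^ 3 * l3 * Θ ^ 3 * hl3Θ)
  have hl3 : l3 = -(l1⁻¹ ^ 3) := by
    field_simp
    linear_combination hl1l3
  have hΘl1 : Θ = l1 ^ 6 := by
    linear_combination l1 ^ 6 * hl3Θ - Θ * (l1 ^ 3 * l3 - 1) * hl1l3
  have hl4 : l4 ^ 2 = l1⁻¹ ^ 12 := by
    rw [hΘl1] at e2
    field_simp
    linear_combination e2
  refine ⟨hl2, hl3, hΘl1, hl4, fun q hq => ⟨?_, ?_, ?_⟩⟩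
  · rw [hl3, hq, ← inv_pow, ← pow_mul]
  · rw [hΘl1, hq, ← pow_mul]
  · rw [← sq_eq_sq_iff_eq_or_eq_neg, hl4, hq, ← inv_pow, ← pow_mul, ← pow_mul]
end

section
/- Let λ = (λ1, λ2) be a dominant G_2 weight and let ω_1 ≠ ω_2 be elements of Ω₀ such that λ+ω_1 and λ+ω_2 are both dominant. Then C_{λ+ω_1} ≠ C_{λ+ω_2}. -/
/-- The `G₂` Casimir scalar `C_λ = ⟨λ+2ρ, λ⟩` of the weight `λ = (λ₁, λ₂)` (identified
with `(λ₁, λ₂, −λ₁−λ₂) ∈ ℝ³`, with `ρ = (2,1,−3)`); explicitly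
`C_λ = 2(λ₁² + λ₁λ₂ + λ₂²) + 10λ₁ + 8λ₂`. -/
def casimirG2 (l : ℤ × ℤ) : ℤ :=
  2 * (l.1 ^ 2 + l.1 * l.2 + l.2 ^ 2) + 10 * l.1 + 8 * l.2

/-- The standard inner product of `ℝ³` expressed on weights:  for `a, b` identified with
`(a₁, a₂, −a₁−a₂)` and `(b₁, b₂, −b₁−b₂)`, one has
`⟨a, b⟩ = 2a₁b₁ + a₁b₂ + a₂b₁ + 2a₂b₂`. -/
def wInner (a b : ℤ × ℤ) : ℤ :=
  2 * a.1 * b.1 + a.1 * b.2 + a.2 * b.1 + 2 * a.2 * b.2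

/-- A `G₂` weight `(λ₁, λ₂)` is dominant if `λ₁ ≥ λ₂ ≥ 0`. -/
def G2Dominant (l : ℤ × ℤ) : Prop := 0 ≤ l.2 ∧ l.2 ≤ l.1

/-- `Ω₀`: the short roots `ε₁−ε₂, ε₂−ε₁, ε₂−ε₃, ε₁−ε₃` of `G₂` together with the zero
weight, written as weights `(a, b)` (for the vector `(a, b, −a−b) ∈ ℝ³`). -/
def Omega0 : Set (ℤ × ℤ) := {(1, -1), (-1, 1), (0, 1), (1, 0), (0, 0)}


/-- For a dominant `G₂` weight `λ` and distinct `ω₁, ω₂ ∈ Ω₀` such that `λ+ω₁` and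
`λ+ω₂` are both dominant, one has `C_{λ+ω₁} ≠ C_{λ+ω₂}`. -/
theorem stmt16 (l ω1 ω2 : ℤ × ℤ) (hdom : G2Dominant l)
    (h1 : ω1 ∈ Omega0) (h2 : ω2 ∈ Omega0) (hne : ω1 ≠ ω2)
    (hd1 : G2Dominant (l + ω1)) (hd2 : G2Dominant (l + ω2)) :
    casimirG2 (l + ω1) ≠ casimirG2 (l + ω2) := by
  obtain ⟨a, b⟩ := l
  simp only [Omega0, Set.mem_insert_iff, Set.mem_singleton_iff] at h1 h2
  rcases h1 with rfl | rfl | rfl | rfl | rfl <;>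
    rcases h2 with rfl | rfl | rfl | rfl | rfl <;>
    simp only [G2Dominant, casimirG2, Prod.mk_add_mk, ne_eq, not_true_eq_false] at * <;>
    ring_nf at * <;> omega
end

section
/- Let k ≥ −2 be an integer, let λ ∈ P_{+,k}, and let ω_1 ≠ ω_2 be elements of Ω₀ such that λ+ω_1 ∈ P_{+,k} and λ+ω_2 ∈ P_{+,k}. Then 2(k+12) does not divide C_{λ+ω_1} − C_{λ+ω_2}. Consequently, if q ∈ ℂ is such that q² is a primitive (k+12)-th root of unity, then q^{C_{λ+ω_1}} ≠ q^{C_{λ+ω_2}}. -/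
/-- `P_{+,k}`: dominant weights `λ` with `λ₁+λ₂ ≤ k/3` if `3 ∣ k`, and
`2λ₁+λ₂ ≤ k+6` if `3 ∤ k`. -/
def inPk (k : ℤ) (l : ℤ × ℤ) : Prop :=
  G2Dominant l ∧ ((3 : ℤ) ∣ k → 3 * (l.1 + l.2) ≤ k) ∧
    (¬ (3 : ℤ) ∣ k → 2 * l.1 + l.2 ≤ k + 6)

/-- A multiple `x` of `d` with `|x| < 2d` is one of `-d`, `0`, `d`. -/
theorem eq_neg_or_zero_or_self_of_dvd {d x : ℤ} (hdvd : d ∣ x) (hlo : -(2 * d) < x)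
    (hhi : x < 2 * d) : x = -d ∨ x = 0 ∨ x = d := by
  obtain ⟨c, rfl⟩ := hdvd
  have hc1 : c < 2 := by nlinarith
  have hc2 : -2 < c := by nlinarith
  interval_cases c <;> simp

/-- Weights `l + ω₁ ≠ l + ω₂` in `P_{+,k}` with `ωᵢ ∈ Ω₀` have Casimir scalars that are
incongruent modulo `2(k+12)`. -/
theorem not_dvd_casimirG2_sub {k : ℤ} (hk : -2 ≤ k) {l ω1 ω2 : ℤ × ℤ}
    (hl : inPk k l) (h1 : ω1 ∈ Omega0) (h2 : ω2 ∈ Omega0) (hne : ω1 ≠ ω2)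
    (hm1 : inPk k (l + ω1)) (hm2 : inPk k (l + ω2)) :
    ¬ 2 * (k + 12) ∣ casimirG2 (l + ω1) - casimirG2 (l + ω2) := by
  obtain ⟨a, b⟩ := l
  intro hdvd
  simp only [Omega0, Set.mem_insert_iff, Set.mem_singleton_iff] at h1 h2
  rcases h1 with rfl | rfl | rfl | rfl | rfl <;> rcases h2 with rfl | rfl | rfl | rfl | rfl <;>
    first
    | exact hne rfl
    | (simp only [inPk, G2Dominant, Prod.mk_add_mk] at hl hm1 hm2
       simp only [casimirG2, Prod.mk_add_mk] at hdvd
       ring_nf at hdvd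
       have := eq_neg_or_zero_or_self_of_dvd hdvd (by omega) (by omega)
       omega)

/-- Every Casimir scalar is even. -/
theorem two_dvd_casimirG2 (l : ℤ × ℤ) : 2 ∣ casimirG2 l :=
  ⟨l.1 ^ 2 + l.1 * l.2 + l.2 ^ 2 + 5 * l.1 + 4 * l.2, by simp only [casimirG2]; ring⟩

/-- If `q²` is a primitive `n`-th root of unity with `n ≠ 0`, then even powers of `q` agree
only if their exponents are congruent modulo `2n`. -/
theorem two_mul_dvd_sub_of_zpow_eq {K : Type*} [Field K] {q : K} {n : ℕ} (hn : n ≠ 0)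
    (hq : IsPrimitiveRoot (q ^ 2) n) {x y : ℤ} (hx : 2 ∣ x) (hy : 2 ∣ y)
    (h : q ^ x = q ^ y) : 2 * (n : ℤ) ∣ x - y := by
  have hq0 : q ≠ 0 := pow_ne_zero_iff two_ne_zero |>.mp (hq.ne_zero hn)
  obtain ⟨c, rfl⟩ := hx
  obtain ⟨d, rfl⟩ := hy
  rw [← mul_sub]
  refine mul_dvd_mul_left 2 ((hq.zpow_eq_one_iff_dvd _).mp ?_)
  rw [← zpow_natCast q 2, ← zpow_mul, Nat.cast_ofNat, mul_sub, zpow_sub₀ hq0, h,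
    div_self (zpow_ne_zero _ hq0)]

/-- Let `k ≥ −2`, `λ ∈ P_{+,k}`, and `ω₁ ≠ ω₂` in `Ω₀` with `λ+ω₁, λ+ω₂ ∈ P_{+,k}`.
Then `2(k+12)` does not divide `C_{λ+ω₁} − C_{λ+ω₂}`; consequently, if `q²` is a
primitive `(k+12)`-th root of unity then `q^{C_{λ+ω₁}} ≠ q^{C_{λ+ω₂}}`. -/
theorem stmt17 (k : ℤ) (hk : -2 ≤ k) (l ω1 ω2 : ℤ × ℤ)
    (hl : inPk k l) (h1 : ω1 ∈ Omega0) (h2 : ω2 ∈ Omega0) (hne : ω1 ≠ ω2)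
    (hm1 : inPk k (l + ω1)) (hm2 : inPk k (l + ω2)) :
    ¬ (2 * (k + 12) ∣ casimirG2 (l + ω1) - casimirG2 (l + ω2)) ∧
    ∀ q : ℂ, IsPrimitiveRoot (q ^ 2) (k + 12).toNat →
      q ^ casimirG2 (l + ω1) ≠ q ^ casimirG2 (l + ω2) := by
  have hndvd := not_dvd_casimirG2_sub hk hl h1 h2 hne hm1 hm2
  refine ⟨hndvd, fun q hq heq => hndvd ?_⟩
  have hdvd := two_mul_dvd_sub_of_zpow_eq (by omega) hq (two_dvd_casimirG2 _)
    (two_dvd_casimirG2 _) heq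
  rwa [Int.toNat_of_nonneg (by omega)] at hdvd
end

section
/- Let k ≥ −2 be an integer. Let ω ∈ {(1,0,−1), (0,1,−1)}, and set Ω = {(1,−1,0), (0,1,−1), (1,0,−1), (0,0,0)} if ω = (1,0,−1) and Ω = {(−1,1,0), (0,1,−1), (1,0,−1), (0,0,0)} if ω = (0,1,−1). Let λ ∈ P_{+,k} with ν := λ+ω ∈ P_{+,k}, and let ω_1 ≠ ω_2 be elements of Ω such that μ_1 := λ+ω_1 ∈ P_{+,k} and μ_2 := λ+ω_2 ∈ P_{+,k}. Then 2(k+12) does not divide C_ν + C_λ − C_{μ_1} − C_{μ_2} − 2. Equivalently, for q ∈ ℂ with q² a primitive (k+12)-th root of unity, one has δ ≠ q²·x_1·x_2, where δ = q^{C_ν − C_λ − 24} and x_i = q^{C_{μ_i} − C_λ − 12}. -/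
/-- The set of intermediate steps `Ω` for a recent `AB₂` representation:
`Ω = {ε₁−ε₂, ε₂−ε₃, ε₁−ε₃, 0}` if `ω = ε₁−ε₃` and
`Ω = {ε₂−ε₁, ε₂−ε₃, ε₁−ε₃, 0}` if `ω = ε₂−ε₃` (written as weight pairs). -/
def recentOmega (ω : ℤ × ℤ) : Set (ℤ × ℤ) :=
  if ω = (1, 0) then {(1, -1), (0, 1), (1, 0), (0, 0)}
  else {(-1, 1), (0, 1), (1, 0), (0, 0)}

/-- The Casimir exponent of a two-step path in `recentOmega ω` is nonzero and has absolute value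
smaller than `2 * (k + 12)`. -/
theorem casimirG2_exponent_ne_zero_and_abs_lt (k : ℤ) (hk : -2 ≤ k) (ω : ℤ × ℤ)
    (hω : ω = (1, 0) ∨ ω = (0, 1)) (l ω1 ω2 : ℤ × ℤ) (hν : inPk k (l + ω))
    (h1 : ω1 ∈ recentOmega ω) (h2 : ω2 ∈ recentOmega ω) (hne : ω1 ≠ ω2) (hl : inPk k l)
    (hm1 : inPk k (l + ω1)) (hm2 : inPk k (l + ω2)) :
    casimirG2 (l + ω) + casimirG2 l - casimirG2 (l + ω1) - casimirG2 (l + ω2) - 2 ≠ 0 ∧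
      |casimirG2 (l + ω) + casimirG2 l - casimirG2 (l + ω1) - casimirG2 (l + ω2) - 2| <
        2 * (k + 12) := by
  obtain ⟨x, y⟩ := l
  rw [abs_lt]
  rcases hω with rfl | rfl <;>
    simp only [recentOmega, Prod.mk.injEq, zero_ne_one, one_ne_zero, and_self, if_true, if_false,
      Set.mem_insert_iff, Set.mem_singleton_iff] at h1 h2 <;>
    rcases h1 with rfl | rfl | rfl | rfl <;>
    rcases h2 with rfl | rfl | rfl | rfl <;>
    first
    | exact absurd rfl hne
    | simp only [inPk, G2Dominant, Prod.mk_add_mk] at hν hl hm1 hm2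
      simp only [casimirG2, Prod.mk_add_mk]
      ring_nf
      by_cases h3 : (3 : ℤ) ∣ k <;>
        simp only [h3, true_implies, not_true_eq_false, not_false_eq_true, false_implies] at * <;>
        omega

theorem even_casimirG2 (l : ℤ × ℤ) : Even (casimirG2 l) :=
  ⟨l.1 ^ 2 + l.1 * l.2 + l.2 ^ 2 + 5 * l.1 + 4 * l.2, by unfold casimirG2; ring⟩

/-- Lemma 5.7 (recent1): for `k ≥ −2`, `ω ∈ {ε₁−ε₃, ε₂−ε₃}`, `λ ∈ P_{+,k}` with
`ν = λ+ω ∈ P_{+,k}`, and distinct `ω₁, ω₂` in the corresponding set `Ω` with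
`μᵢ = λ+ωᵢ ∈ P_{+,k}`:  `2(k+12)` does not divide `C_ν + C_λ − C_{μ₁} − C_{μ₂} − 2`;
equivalently, for `q²` a primitive `(k+12)`-th root of unity, `δ ≠ q²·x₁·x₂` where
`δ = q^{C_ν − C_λ − 24}` and `xᵢ = q^{C_{μᵢ} − C_λ − 12}`. -/
theorem stmt18 (k : ℤ) (hk : -2 ≤ k) (ω : ℤ × ℤ) (hω : ω = (1, 0) ∨ ω = (0, 1))
    (l ω1 ω2 : ℤ × ℤ) (hl : inPk k l) (hν : inPk k (l + ω))
    (h1 : ω1 ∈ recentOmega ω) (h2 : ω2 ∈ recentOmega ω) (hne : ω1 ≠ ω2)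
    (hm1 : inPk k (l + ω1)) (hm2 : inPk k (l + ω2)) :
    ¬ (2 * (k + 12) ∣
        casimirG2 (l + ω) + casimirG2 l - casimirG2 (l + ω1) - casimirG2 (l + ω2) - 2) ∧
    ∀ q : ℂ, IsPrimitiveRoot (q ^ 2) (k + 12).toNat →
      q ^ (casimirG2 (l + ω) - casimirG2 l - 24) ≠
        q ^ 2 * q ^ (casimirG2 (l + ω1) - casimirG2 l - 12) *
          q ^ (casimirG2 (l + ω2) - casimirG2 l - 12) := by
  have hndvd : ¬ (2 * (k + 12) ∣
      casimirG2 (l + ω) + casimirG2 l - casimirG2 (l + ω1) - casimirG2 (l + ω2) - 2) := by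
    obtain ⟨h0, hlt⟩ := casimirG2_exponent_ne_zero_and_abs_lt k hk ω hω l ω1 ω2 hν h1 h2 hne hl
      hm1 hm2
    exact fun hdvd => h0 (Int.eq_zero_of_abs_lt_dvd hdvd hlt)
  refine ⟨hndvd, fun q hq heq => hndvd ?_⟩
  have hq0 : q ≠ 0 := by
    rintro rfl
    exact hq.ne_zero (by omega) (by simp)
  have heven : Even (casimirG2 (l + ω) + casimirG2 l - casimirG2 (l + ω1)
      - casimirG2 (l + ω2) - 2) :=
    ((((even_casimirG2 _).add (even_casimirG2 _)).sub (even_casimirG2 _)).sub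
      (even_casimirG2 _)).sub even_two
  obtain ⟨m, hm⟩ := heven
  have hpow : (q ^ 2) ^ m = 1 := by
    rw [← zpow_natCast q 2, ← zpow_mul]
    rw [← zpow_natCast q 2, ← zpow_add₀ hq0, ← zpow_add₀ hq0] at heq
    have hdiff := div_eq_one_iff_eq (zpow_ne_zero _ hq0) |>.mpr heq
    rw [← zpow_sub₀ hq0] at hdiff
    rw [← hdiff]
    congr 1
    push_cast
    linarith
  have hdvd := (hq.zpow_eq_one_iff_dvd m).mp hpow
  rw [Int.toNat_of_nonneg (by omega)] at hdvd
  rw [hm, ← two_mul]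
  exact mul_dvd_mul_left 2 hdvd
end

section
/- Let k ≥ 0 be an integer divisible by 3. Let ω ∈ {(1,0,−1), (0,1,−1)}, and set Ω = {(1,−1,0), (0,1,−1), (1,0,−1), (0,0,0)} if ω = (1,0,−1) and Ω = {(−1,1,0), (0,1,−1), (1,0,−1), (0,0,0)} if ω = (0,1,−1). Let λ ∈ P_{+,k} with ν := λ+ω ∈ P_{+,k}, and let ω_1 ∈ Ω be such that μ := λ+ω_1 ∈ P_{+,k}. Then, setting X = C_ν + C_λ − 2C_μ, the number 2(k+12) divides neither X nor X − 4. Equivalently, for q ∈ ℂ with q² a primitive (k+12)-th root of unity, δ ∉ {x², q⁴x²}, where δ = q^{C_ν − C_λ − 24} and x = q^{C_μ − C_λ − 12}. -/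
/-- A positive integer does not divide a nonzero integer of smaller absolute value. -/
theorem not_dvd_of_ne_zero_of_abs_lt {n x : ℤ} (hx : x ≠ 0) (h : |x| < n) : ¬ n ∣ x :=
  fun hd => hx (Int.eq_zero_of_abs_lt_dvd hd h)

/-- If `q²` is a primitive `n`-th root of unity and `q ^ y = 1` with `y` even, then
`2 * n` divides `y`. -/
theorem two_mul_dvd_of_zpow_eq_one {q : ℂ} {n y : ℤ} (hn : 0 ≤ n)
    (hq : IsPrimitiveRoot (q ^ 2) n.toNat) (hy : Even y) (h : q ^ y = 1) : 2 * n ∣ y := by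
  obtain ⟨m, rfl⟩ := hy
  have hm : (q ^ 2) ^ m = 1 := by
    rw [← h, ← zpow_natCast, ← zpow_mul]
    congr 1
    push_cast
    ring
  have hd := (hq.zpow_eq_one_iff_dvd m).1 hm
  rw [Int.toNat_of_nonneg hn] at hd
  rw [← two_mul]
  exact mul_dvd_mul_left 2 hd

/-- Lemma 5.8 (recent2), case `3 ∣ k`: for `k ≥ 0` divisible by `3`,
`ω ∈ {ε₁−ε₃, ε₂−ε₃}`, `λ ∈ P_{+,k}` with `ν = λ+ω ∈ P_{+,k}`, and `ω₁` in the
corresponding set `Ω` with `μ = λ+ω₁ ∈ P_{+,k}`:  setting `X = C_ν + C_λ − 2C_μ`,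
the number `2(k+12)` divides neither `X` nor `X − 4`; equivalently, for `q²` a primitive
`(k+12)`-th root of unity, `δ ∉ {x², q⁴x²}` where `δ = q^{C_ν − C_λ − 24}` and
`x = q^{C_μ − C_λ − 12}`. -/
theorem stmt19 (k : ℤ) (hk : 0 ≤ k) (h3k : (3 : ℤ) ∣ k)
    (ω : ℤ × ℤ) (hω : ω = (1, 0) ∨ ω = (0, 1))
    (l ω1 : ℤ × ℤ) (hl : inPk k l) (hν : inPk k (l + ω))
    (h1 : ω1 ∈ recentOmega ω) (hm : inPk k (l + ω1)) :
    (¬ (2 * (k + 12) ∣ casimirG2 (l + ω) + casimirG2 l - 2 * casimirG2 (l + ω1)) ∧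
     ¬ (2 * (k + 12) ∣ casimirG2 (l + ω) + casimirG2 l - 2 * casimirG2 (l + ω1) - 4)) ∧
    ∀ q : ℂ, IsPrimitiveRoot (q ^ 2) (k + 12).toNat →
      q ^ (casimirG2 (l + ω) - casimirG2 l - 24) ≠
        (q ^ (casimirG2 (l + ω1) - casimirG2 l - 12)) ^ 2 ∧
      q ^ (casimirG2 (l + ω) - casimirG2 l - 24) ≠
        q ^ 4 * (q ^ (casimirG2 (l + ω1) - casimirG2 l - 12)) ^ 2 := by
  obtain ⟨a, b⟩ := l
  obtain ⟨⟨hb, hab⟩, hk1, -⟩ := hl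
  obtain ⟨⟨hb', hab'⟩, hk2, -⟩ := hν
  obtain ⟨⟨hb'', hab''⟩, hk3, -⟩ := hm
  replace hk1 := hk1 h3k
  replace hk2 := hk2 h3k
  replace hk3 := hk3 h3k
  have hdvd :
      ¬ (2 * (k + 12) ∣
        casimirG2 ((a, b) + ω) + casimirG2 (a, b) - 2 * casimirG2 ((a, b) + ω1)) ∧
      ¬ (2 * (k + 12) ∣
        casimirG2 ((a, b) + ω) + casimirG2 (a, b) - 2 * casimirG2 ((a, b) + ω1) - 4) := by
    rcases hω with rfl | rfl <;>
      simp [recentOmega] at h1 <;>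
      rcases h1 with rfl | rfl | rfl | rfl <;>
      simp only [Prod.mk_add_mk] at * <;>
      constructor <;>
      apply not_dvd_of_ne_zero_of_abs_lt <;>
      simp only [casimirG2, abs_lt] <;>
      ring_nf <;>
      omega
  refine ⟨hdvd, fun q hq => ?_⟩
  have hq0 : q ≠ 0 := by
    rintro rfl
    exact hq.ne_zero (by omega) (by simp)
  have heven : Even (casimirG2 ((a, b) + ω) + casimirG2 (a, b)
      - 2 * casimirG2 ((a, b) + ω1)) :=
    ((even_casimirG2 _).add (even_casimirG2 _)).sub (even_two_mul _)
  constructor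
  · intro h
    refine hdvd.1 (two_mul_dvd_of_zpow_eq_one (by omega) hq heven ?_)
    rw [← zpow_natCast, ← zpow_mul] at h
    rw [← div_eq_one_iff_eq (zpow_ne_zero _ hq0), ← zpow_sub₀ hq0] at h
    rw [← h]
    congr 1
    push_cast
    ring
  · intro h
    refine hdvd.2 (two_mul_dvd_of_zpow_eq_one (by omega) hq (heven.sub (by decide)) ?_)
    rw [← zpow_natCast, ← zpow_natCast, ← zpow_mul, ← zpow_add₀ hq0] at h
    rw [← div_eq_one_iff_eq (zpow_ne_zero _ hq0), ← zpow_sub₀ hq0] at h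
    rw [← h]
    congr 1
    push_cast
    ring
end
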